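/- arXiv:1708.06064 — 2 statements merged into one kernel-verified Lean document; each statement's English description precedes it below -/
import Mathlib

section
/- Let B be a set of exactly five points in the plane and R a finite set disjoint from B, with B ∪ R in strong general position. Then B is separable from R, i.e., there exists a simple polygon with at most 5 convex vertices whose interior contains all points of R and which contains no point of B. -/
open scoped RealInnerProductSpace ENNReal Classical

noncomputable section

/-- Points of the Euclidean plane. -/
abbrev Pt : Type := EuclideanSpace ℝ (Fin 2)

/-- The planar determinant `det (u, v)` of two vectors. -/
def det2 (u v : Pt) : ℝ := u 0 * v 1 - u 1 * v 0

/-- No three of the points of `S` are collinear. -/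
def NoThreeCollinear (S : Set Pt) : Prop :=
  ∀ p ∈ S, ∀ q ∈ S, ∀ r ∈ S, p ≠ q → p ≠ r → q ≠ r → det2 (q - p) (r - p) ≠ 0

/-- `S` is in strong general position: no three points are collinear and for any four
distinct points `p₁ p₂ p₃ p₄` the line through `p₁,p₂` is not parallel to the line
through `p₃,p₄`. -/
def StrongGenPos (S : Set Pt) : Prop :=
  NoThreeCollinear S ∧
    ∀ p₁ ∈ S, ∀ p₂ ∈ S, ∀ p₃ ∈ S, ∀ p₄ ∈ S,
      p₁ ≠ p₂ → p₁ ≠ p₃ → p₁ ≠ p₄ → p₂ ≠ p₃ → p₂ ≠ p₄ → p₃ ≠ p₄ →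
        det2 (p₂ - p₁) (p₄ - p₃) ≠ 0

/-- A simple polygon, given by a cyclic sequence of `n ≥ 3` distinct vertices
(encoded as an `n`-periodic function `ℕ → Pt`), such that no point of the plane lies on
more than two closed edges, and the only points lying on exactly two edges are vertices. -/
structure SimplePolygon where
  n : ℕ
  three_le : 3 ≤ n
  vtx : ℕ → Pt
  periodic : ∀ i, vtx (i + n) = vtx i
  inj : ∀ i < n, ∀ j < n, vtx i = vtx j → i = j
  simple : ∀ x : Pt, {i | i < n ∧ x ∈ segment ℝ (vtx i) (vtx (i + 1))}.ncard ≤ 2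
  vtx_of_two : ∀ x : Pt,
    {i | i < n ∧ x ∈ segment ℝ (vtx i) (vtx (i + 1))}.ncard = 2 → ∃ i < n, x = vtx i

namespace SimplePolygon

/-- The boundary of a simple polygon: the union of its closed edges. -/
def boundary (P : SimplePolygon) : Set Pt :=
  ⋃ i ∈ Finset.range P.n, segment ℝ (P.vtx i) (P.vtx (i + 1))

/-- The interior of a simple polygon: the union of the bounded connected components of the
complement of the boundary. -/
def interior (P : SimplePolygon) : Set Pt :=
  {x | x ∉ P.boundary ∧ Bornology.IsBounded (connectedComponentIn P.boundaryᶜ x)}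

/-- A simple polygon, regarded as a point set: boundary together with interior. -/
def region (P : SimplePolygon) : Set Pt := P.boundary ∪ P.interior

/-- The set of vertices of the polygon. -/
def vertexSet (P : SimplePolygon) : Set Pt := {x | ∃ i < P.n, x = P.vtx i}

/-- Twice the shoelace signed area. -/
def shoelace (P : SimplePolygon) : ℝ := ∑ i ∈ Finset.range P.n, det2 (P.vtx i) (P.vtx (i + 1))

/-- The vertices are listed in counterclockwise order (positive shoelace signed area). -/
def CCW (P : SimplePolygon) : Prop := 0 < P.shoelace

/-- The vertex `vtx (i+1)` is a convex vertex:
`det (v_{i+1} − v_i, v_{i+2} − v_{i+1}) > 0` (vertices listed counterclockwise). -/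
def ConvexAt (P : SimplePolygon) (i : ℕ) : Prop :=
  0 < det2 (P.vtx (i + 1) - P.vtx i) (P.vtx (i + 2) - P.vtx (i + 1))

/-- The number of convex vertices of the polygon. -/
def numConvex (P : SimplePolygon) : ℕ := {i | i < P.n ∧ P.ConvexAt i}.ncard

/-- Continuous paths from `s` to `t` staying inside the polygon. -/
def pathsIn (P : SimplePolygon) (s t : Pt) : Set (ℝ → Pt) :=
  {γ | ContinuousOn γ (Set.Icc 0 1) ∧ γ 0 = s ∧ γ 1 = t ∧ γ '' Set.Icc (0 : ℝ) 1 ⊆ P.region}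

/-- The geodesic distance between `s` and `t` inside the polygon: the infimum of the
lengths (total variations) of continuous paths in the polygon from `s` to `t`. -/
def geodDist (P : SimplePolygon) (s t : Pt) : ℝ≥0∞ :=
  ⨅ γ ∈ P.pathsIn s t, eVariationOn γ (Set.Icc 0 1)

end SimplePolygon

/-- Length of a polygonal path through a list of points. -/
def polylineLen : List Pt → ℝ
  | [] => 0
  | [_] => 0
  | a :: b :: l => dist a b + polylineLen (b :: l)

/-- The polygonal path through a list of points, as a point set. -/
def polylineSet : List Pt → Set Pt
  | [] => ∅
  | [a] => {a}
  | a :: b :: l => segment ℝ a b ∪ polylineSet (b :: l)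

/-- `L` is the vertex sequence of the geodesic from `s` to `t` inside the polygon `P`:
a polygonal path inside `P` from `s` to `t`, with consecutive vertices distinct, with no
three consecutive vertices collinear, whose length realizes the geodesic distance. -/
def SimplePolygon.IsGeodesicChain (P : SimplePolygon) (s t : Pt) (L : List Pt) : Prop :=
  L.head? = some s ∧ L.getLast? = some t ∧ List.Chain' (· ≠ ·) L ∧
  (∀ i, i + 2 < L.length →
      det2 (L.getD (i + 1) 0 - L.getD i 0) (L.getD (i + 2) 0 - L.getD i 0) ≠ 0) ∧
  polylineSet L ⊆ P.region ∧
  ENNReal.ofReal (polylineLen L) = P.geodDist s t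

/-- The triple `(p,q,r)` is in geodesic counterclockwise order with respect to `P`:
writing the geodesics `π(p,q) = ⟨p = v₀, …, v_k = q⟩` and `π(p,r) = ⟨p = u₀, …, u_{k'} = r⟩`
and taking the smallest index `i > 0` with `v_i ≠ u_i`, we have
`det (v_i − v_{i−1}, u_i − v_{i−1}) > 0`. -/
def geodesicCCW (P : SimplePolygon) (p q r : Pt) : Prop :=
  ∃ L M : List Pt, P.IsGeodesicChain p q L ∧ P.IsGeodesicChain p r M ∧
    ∃ i : ℕ, 0 < i ∧ (∀ j < i, L[j]? = M[j]?) ∧ L[i]? ≠ M[i]? ∧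
      ∃ a b c : Pt, L[i - 1]? = some a ∧ L[i]? = some b ∧ M[i]? = some c ∧
        0 < det2 (b - a) (c - a)

/-- The triple `(p,q,r)` is in geodesic clockwise order with respect to `P`. -/
def geodesicCW (P : SimplePolygon) (p q r : Pt) : Prop :=
  ∃ L M : List Pt, P.IsGeodesicChain p q L ∧ P.IsGeodesicChain p r M ∧
    ∃ i : ℕ, 0 < i ∧ (∀ j < i, L[j]? = M[j]?) ∧ L[i]? ≠ M[i]? ∧
      ∃ a b c : Pt, L[i - 1]? = some a ∧ L[i]? = some b ∧ M[i]? = some c ∧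
        det2 (b - a) (c - a) < 0

/-- `C ⊆ P` is geodesically convex: for all `p, q ∈ C` the geodesic connecting them
stays inside `C`. -/
def GeodesicallyConvex (P : SimplePolygon) (C : Set Pt) : Prop :=
  C ⊆ P.region ∧ ∀ p ∈ C, ∀ q ∈ C, ∀ L, P.IsGeodesicChain p q L → polylineSet L ⊆ C

/-- The geodesic hull `CH_P(U)`: the intersection of all geodesically convex subsets of `P`
containing `U`. -/
def geodesicHull (P : SimplePolygon) (U : Set Pt) : Set Pt :=
  ⋂₀ {C | GeodesicallyConvex P C ∧ U ⊆ C}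

/-- `E_P(S)`: the set of points of `S` lying on the (topological) boundary of the geodesic
hull of `S` with respect to `P`. -/
def extremeSet (P : SimplePolygon) (S : Set Pt) : Set Pt :=
  {x ∈ S | x ∈ frontier (geodesicHull P S)}

/-- `B` is separable from `R`: there is a simple polygon with at most `|B|` convex vertices
whose interior contains all points of `R` and which contains no point of `B`. -/
def Separable (B R : Finset Pt) : Prop :=
  ∃ P : SimplePolygon, P.CCW ∧ P.numConvex ≤ B.card ∧
    (∀ r ∈ R, r ∈ P.interior) ∧ ∀ b ∈ B, b ∉ P.region

open scoped Topology

/-- Twice the signed area of the triangle `a b c` in coordinates. -/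
def orient (a b c : ℝ × ℝ) : ℝ :=
  (b.1 - a.1) * (c.2 - a.2) - (b.2 - a.2) * (c.1 - a.1)

/-- The closed triangle with counterclockwise vertices `a b c`. -/
def closedTri (a b c : ℝ × ℝ) : Set (ℝ × ℝ) :=
  {x | 0 ≤ orient a b x ∧ 0 ≤ orient b c x ∧ 0 ≤ orient c a x}

/-- Two directed edges meet at most in the head of one and the tail of the other. -/
def EdgeRel {V : Type*} [AddCommGroup V] [Module ℝ V] (e f : V × V) : Prop :=
  ∀ x ∈ segment ℝ e.1 e.2, x ∈ segment ℝ f.1 f.2 →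
    (x = e.2 ∧ x = f.1) ∨ (x = e.1 ∧ x = f.2)

/-- The edges `es` form a simple closed curve whose complement is split into a bounded open
set `I` and an unbounded connected open set `E`. -/
structure Bounds {V : Type*} [NormedAddCommGroup V] [NormedSpace ℝ V]
    (es : List (V × V)) (I E : Set V) : Prop where
  pairwise : es.Pairwise EdgeRel
  nodup : (es.map Prod.fst).Nodup
  ne : ∀ e ∈ es, e.1 ≠ e.2
  isOpen_int : IsOpen I
  isOpen_ext : IsOpen E
  bounded_int : Bornology.IsBounded I
  preconnected_ext : IsPreconnected E
  unbounded_ext : ¬ Bornology.IsBounded E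
  disj : ∀ x ∈ I, x ∉ E
  cover : ∀ x, x ∈ I ∨ x ∈ E ∨ ∃ e ∈ es, x ∈ segment ℝ e.1 e.2
  int_notMem : ∀ x ∈ I, ∀ e ∈ es, x ∉ segment ℝ e.1 e.2
  ext_notMem : ∀ x ∈ E, ∀ e ∈ es, x ∉ segment ℝ e.1 e.2

/-- Just to the right of every edge lies the set `E`. -/
def RightOf (es : List ((ℝ × ℝ) × (ℝ × ℝ))) (E : Set (ℝ × ℝ)) : Prop :=
  ∀ e ∈ es, ∀ x ∈ openSegment ℝ e.1 e.2, ∀ᶠ y in 𝓝 x, orient e.1 e.2 y < 0 → y ∈ E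

lemma EdgeRel.symm {V : Type*} [AddCommGroup V] [Module ℝ V] {e f : V × V}
    (h : EdgeRel e f) : EdgeRel f e := fun x hx hy => by
  rcases h x hy hx with ⟨h1, h2⟩ | ⟨h1, h2⟩
  · exact Or.inr ⟨h2, h1⟩
  · exact Or.inl ⟨h2, h1⟩

lemma Bounds.perm {V : Type*} [NormedAddCommGroup V] [NormedSpace ℝ V]
    {es fs : List (V × V)} {I E : Set V} (h : Bounds es I E) (p : es.Perm fs) :
    Bounds fs I E where
  pairwise := (p.pairwise_iff (fun h => EdgeRel.symm h)).1 h.pairwise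
  nodup := (p.map Prod.fst).nodup_iff.1 h.nodup
  ne e he := h.ne e (p.mem_iff.2 he)
  isOpen_int := h.isOpen_int
  isOpen_ext := h.isOpen_ext
  bounded_int := h.bounded_int
  preconnected_ext := h.preconnected_ext
  unbounded_ext := h.unbounded_ext
  disj := h.disj
  cover x := by
    rcases h.cover x with h | h | ⟨e, he, hx⟩
    · exact Or.inl h
    · exact Or.inr (Or.inl h)
    · exact Or.inr (Or.inr ⟨e, p.mem_iff.1 he, hx⟩)
  int_notMem x hx e he := h.int_notMem x hx e (p.mem_iff.2 he)
  ext_notMem x hx e he := h.ext_notMem x hx e (p.mem_iff.2 he)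

lemma RightOf.perm {es fs : List ((ℝ × ℝ) × (ℝ × ℝ))} {E : Set (ℝ × ℝ)} (h : RightOf es E)
    (p : es.Perm fs) : RightOf fs E := fun e he => h e (p.mem_iff.2 he)

@[fun_prop]
lemma continuous_orient {X : Type*} [TopologicalSpace X] {f g h : X → ℝ × ℝ} (hf : Continuous f)
    (hg : Continuous g) (hh : Continuous h) : Continuous fun x => orient (f x) (g x) (h x) := by
  unfold orient; fun_prop

lemma isClosed_closedTri (a b c : ℝ × ℝ) : IsClosed (closedTri a b c) :=
  (isClosed_le continuous_const (continuous_orient (by fun_prop) (by fun_prop) continuous_id)).inter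
    ((isClosed_le continuous_const
      (continuous_orient (by fun_prop) (by fun_prop) continuous_id)).inter
      (isClosed_le continuous_const
        (continuous_orient (by fun_prop) (by fun_prop) continuous_id)))

lemma orient_rotate (a b c : ℝ × ℝ) : orient b c a = orient a b c := by
  unfold orient; ring

lemma orient_swap (a b c : ℝ × ℝ) : orient b a c = - orient a b c := by
  unfold orient; ring

lemma orient_sum (a b c x : ℝ × ℝ) :
    orient a b x + orient b c x + orient c a x = orient a b c := by
  unfold orient; ring

lemma orient_combo (a b p q : ℝ × ℝ) {s t : ℝ} (h : s + t = 1) :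
    orient a b (s • p + t • q) = s * orient a b p + t * orient a b q := by
  obtain rfl : s = 1 - t := by linarith
  simp only [orient, Prod.fst_add, Prod.snd_add, Prod.smul_fst, Prod.smul_snd, smul_eq_mul]
  ring

@[simp] lemma orient_left (a b : ℝ × ℝ) : orient a b a = 0 := by unfold orient; ring

@[simp] lemma orient_right (a b : ℝ × ℝ) : orient a b b = 0 := by unfold orient; ring

@[simp] lemma orient_same (a b : ℝ × ℝ) : orient a a b = 0 := by unfold orient; ring

lemma orient_barycentric (a b c x : ℝ × ℝ) :
    orient a b c • x = orient b c x • a + orient c a x • b + orient a b x • c := by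
  ext <;> simp [orient] <;> ring

lemma mem_segment_iff {a b c x : ℝ × ℝ} (h : 0 < orient a b c) :
    x ∈ segment ℝ a b ↔ orient a b x = 0 ∧ 0 ≤ orient b c x ∧ 0 ≤ orient c a x := by
  constructor
  · rintro ⟨s, t, hs, ht, hst, rfl⟩
    refine ⟨by simp [orient_combo _ _ _ _ hst], ?_, ?_⟩
    · rw [orient_combo _ _ _ _ hst, orient_rotate]; simp; positivity
    · rw [orient_combo _ _ _ _ hst, ← orient_rotate c a b]
      simp; positivity
  · rintro ⟨h0, h1, h2⟩
    have hs := orient_sum a b c x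
    have hb := orient_barycentric a b c x
    refine ⟨orient b c x / orient a b c, orient c a x / orient a b c, by positivity,
      by positivity, ?_, ?_⟩
    · field_simp; linarith
    · rw [h0, zero_smul, add_zero] at hb
      rw [div_eq_inv_mul, div_eq_inv_mul, mul_smul, mul_smul, ← smul_add, ← hb, smul_smul,
        inv_mul_cancel₀ h.ne', one_smul]

lemma orient_pos_of_mem_openSegment {a b c x : ℝ × ℝ} (h : 0 < orient a b c)
    (hx : x ∈ openSegment ℝ a b) :
    orient a b x = 0 ∧ 0 < orient b c x ∧ 0 < orient c a x := by
  obtain ⟨s, t, hs, ht, hst, rfl⟩ := hx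
  refine ⟨by simp [orient_combo _ _ _ _ hst], ?_, ?_⟩
  · rw [orient_combo _ _ _ _ hst, orient_rotate]; simp; positivity
  · rw [orient_combo _ _ _ _ hst, ← orient_rotate c a b]
    simp; positivity

lemma mem_openSegment_of_orient {a b c x : ℝ × ℝ} (h : 0 < orient a b c)
    (h0 : orient a b x = 0) (h1 : 0 < orient b c x) (h2 : 0 < orient c a x) :
    x ∈ openSegment ℝ a b := by
  have hs := orient_sum a b c x
  have hb := orient_barycentric a b c x
  refine ⟨orient b c x / orient a b c, orient c a x / orient a b c, by positivity,
    by positivity, ?_, ?_⟩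
  · field_simp; linarith
  · rw [h0, zero_smul, add_zero] at hb
    rw [div_eq_inv_mul, div_eq_inv_mul, mul_smul, mul_smul, ← smul_add, ← hb, smul_smul,
      inv_mul_cancel₀ h.ne', one_smul]

lemma ne_of_orient_pos {a b c : ℝ × ℝ} (h : 0 < orient a b c) : a ≠ b ∧ b ≠ c ∧ c ≠ a := by
  refine ⟨?_, ?_, ?_⟩ <;> rintro rfl
  · simp at h
  · simp at h
  · simp at h

lemma convex_orient_pos (a b : ℝ × ℝ) : Convex ℝ {x | 0 < orient a b x} := by
  intro x hx y hy s t hs ht hst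
  simp only [Set.mem_ofPred_eq, orient_combo _ _ _ _ hst] at *
  rcases hs.eq_or_lt with rfl | hs
  · obtain rfl : t = 1 := by linarith
    simpa using hy
  · positivity

lemma convex_orient_nonneg (a b : ℝ × ℝ) : Convex ℝ {x | 0 ≤ orient a b x} := by
  intro x hx y hy s t hs ht hst
  simp only [Set.mem_ofPred_eq, orient_combo _ _ _ _ hst] at *
  positivity

/-- The open triangle together with its open base `a b`. -/
def baseTri (a b c : ℝ × ℝ) : Set (ℝ × ℝ) :=
  {x | 0 ≤ orient a b x ∧ 0 < orient b c x ∧ 0 < orient c a x}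

/-- Replacing the edge `a b` by `a c` and `c b`, cutting the triangle `a b c` off `I`. -/
lemma Bounds.dent {a b c : ℝ × ℝ} {es : List ((ℝ × ℝ) × (ℝ × ℝ))} {I E : Set (ℝ × ℝ)}
    (h : Bounds ((a, b) :: es) I E) (hr : RightOf ((a, b) :: es) E) (hc : 0 < orient a b c)
    (hsub : ∀ x ∈ closedTri a b c, 0 < orient a b x → x ∈ I) :
    Bounds ((a, c) :: (c, b) :: es) (I \ closedTri a b c) (E ∪ baseTri a b c) ∧
      RightOf ((a, c) :: (c, b) :: es) (E ∪ baseTri a b c) := by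
  obtain ⟨hab, hbc, hca⟩ := ne_of_orient_pos hc
  have hc1 : 0 < orient b c a := by rwa [orient_rotate]
  have hc2 : 0 < orient c a b := by rwa [orient_rotate, orient_rotate]
  have seg1 : ∀ x, x ∈ segment ℝ a c ↔
      orient c a x = 0 ∧ 0 ≤ orient a b x ∧ 0 ≤ orient b c x := fun x => by
    rw [segment_symm, mem_segment_iff hc2]
  have seg2 : ∀ x, x ∈ segment ℝ c b ↔
      orient b c x = 0 ∧ 0 ≤ orient c a x ∧ 0 ≤ orient a b x := fun x => by
    rw [segment_symm, mem_segment_iff hc1]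
  have seg0 := fun x => mem_segment_iff (x := x) hc
  have hp := List.pairwise_cons.1 h.pairwise
  have hn := h.nodup
  simp only [List.map_cons, List.nodup_cons] at hn
  have hcI : c ∈ I := hsub c ⟨hc.le, by simp, by simp⟩ hc
  have tri_I : ∀ x ∈ closedTri a b c, orient a b x = 0 ∨ x ∈ I := fun x hx => by
    rcases hx.1.eq_or_lt with h0 | h0
    · exact Or.inl h0.symm
    · exact Or.inr (hsub x hx h0)
  have base_es : ∀ x, orient a b x = 0 → 0 ≤ orient b c x → 0 ≤ orient c a x →
      ∀ f ∈ es, x ∈ segment ℝ f.1 f.2 → (x = b ∧ x = f.1) ∨ (x = a ∧ x = f.2) :=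
    fun x h0 h1 h2 f hf hx => hp.1 f hf x ((seg0 x).2 ⟨h0, h1, h2⟩) hx
  have hE : IsOpen (E ∪ baseTri a b c) := by
    rw [isOpen_iff_mem_nhds]
    rintro x (hx | ⟨h0, h1, h2⟩)
    · exact Filter.mem_of_superset (h.isOpen_ext.mem_nhds hx) Set.subset_union_left
    · have e1 : ∀ᶠ y in 𝓝 x, 0 < orient b c y :=
        (isOpen_lt continuous_const (by fun_prop)).mem_nhds h1
      have e2 : ∀ᶠ y in 𝓝 x, 0 < orient c a y :=
        (isOpen_lt continuous_const (by fun_prop)).mem_nhds h2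
      have e0 : ∀ᶠ y in 𝓝 x, orient a b y < 0 → y ∈ E := by
        rcases h0.eq_or_lt with h0 | h0
        · exact hr (a, b) (by simp) x (mem_openSegment_of_orient hc h0.symm h1 h2)
        · have : ∀ᶠ y in 𝓝 x, 0 < orient a b y :=
            (isOpen_lt continuous_const (by fun_prop)).mem_nhds h0
          filter_upwards [this] with y hy hy'
          linarith
      filter_upwards [e0, e1, e2] with y y0 y1 y2
      rcases lt_or_ge (orient a b y) 0 with hy | hy
      · exact Or.inl (y0 hy)
      · exact Or.inr ⟨hy, y1, y2⟩
  have hconn : IsPreconnected (E ∪ baseTri a b c) := by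
    set q : ℝ × ℝ := (1 / 2 : ℝ) • a + (1 / 2 : ℝ) • b with hq
    have hqs : q ∈ openSegment ℝ a b := ⟨1 / 2, 1 / 2, by norm_num, by norm_num, by norm_num, rfl⟩
    obtain ⟨q0, q1, q2⟩ := orient_pos_of_mem_openSegment hc hqs
    have hqN : q ∈ baseTri a b c := ⟨q0.ge, q1, q2⟩
    have hqE : q ∈ closure E := by
      have hev := hr (a, b) (by simp) q hqs
      have ht : Filter.Tendsto (fun s : ℝ => (1 + s) • q + (-s) • c) (𝓝[>] 0) (𝓝 q) := by
        have : Continuous fun s : ℝ => (1 + s) • q + (-s) • c := by fun_prop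
        have := this.tendsto 0
        simp only [add_zero, one_smul, neg_zero, zero_smul] at this
        exact this.mono_left nhdsWithin_le_nhds
      refine mem_closure_of_tendsto ht ?_
      filter_upwards [ht.eventually hev, self_mem_nhdsWithin] with s hs hs0
      apply hs
      have hs0 : 0 < s := hs0
      rw [orient_combo _ _ _ _ (by ring), q0]
      nlinarith
    have hconv : Convex ℝ (baseTri a b c) :=
      (convex_orient_nonneg a b).inter ((convex_orient_pos b c).inter (convex_orient_pos c a))
    have h1 : IsPreconnected (E ∪ {q}) :=
      h.preconnected_ext.subset_closure Set.subset_union_left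
        (Set.union_subset subset_closure (by simpa using hqE))
    have h2 := h1.union q (by simp) hqN hconv.isPreconnected
    convert h2 using 1
    ext x
    simp only [Set.mem_union, Set.mem_singleton_iff]
    constructor
    · tauto
    · rintro ((h | rfl) | h)
      · exact Or.inl h
      · exact Or.inr hqN
      · exact Or.inr h
  refine ⟨⟨?_, ?_, ?_, ?_, hE, ?_, hconn, ?_, ?_, ?_, ?_, ?_⟩, ?_⟩
  · rw [List.pairwise_cons, List.pairwise_cons]
    refine ⟨fun f hf x hx hx' => ?_, fun f hf x hx hx' => ?_, hp.2⟩
    · rcases List.mem_cons.1 hf with rfl | hf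
      · obtain ⟨x1, x2, x3⟩ := (seg1 x).1 hx
        obtain ⟨y1, y2, y3⟩ := (seg2 x).1 hx'
        have hb := orient_barycentric a b c x
        have hs := orient_sum a b c x
        rw [x1, y1] at hb hs
        simp only [zero_smul, zero_add, add_zero] at hb hs
        rw [hs] at hb
        have := smul_right_injective _ hc.ne' hb
        exact Or.inl ⟨this, this⟩
      · obtain ⟨x1, x2, x3⟩ := (seg1 x).1 hx
        rcases tri_I x ⟨x2, x3, x1.ge⟩ with h0 | hI
        · rcases base_es x h0 x3 x1.ge f hf hx' with ⟨rfl, -⟩ | h'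
          · exact absurd x1 hc2.ne'
          · exact Or.inr h'
        · exact absurd hx' (h.int_notMem x hI f (List.mem_cons_of_mem _ hf))
    · obtain ⟨x1, x2, x3⟩ := (seg2 x).1 hx
      rcases tri_I x ⟨x3, x1.ge, x2⟩ with h0 | hI
      · rcases base_es x h0 x1.ge x2 f hf hx' with h' | ⟨rfl, -⟩
        · exact Or.inl h'
        · exact absurd x1 hc1.ne'
      · exact absurd hx' (h.int_notMem x hI f (List.mem_cons_of_mem _ hf))
  · simp only [List.map_cons, List.nodup_cons, List.mem_cons, not_or]
    refine ⟨⟨hca.symm, hn.1⟩, ?_, hn.2⟩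
    intro hmem
    obtain ⟨f, hf, hfc⟩ := List.mem_map.1 hmem
    exact h.int_notMem c hcI f (List.mem_cons_of_mem _ hf) (hfc ▸ left_mem_segment ℝ f.1 f.2)
  · intro e he
    rcases List.mem_cons.1 he with rfl | he
    · exact hca.symm
    · rcases List.mem_cons.1 he with rfl | he
      · exact hbc.symm
      · exact h.ne e (List.mem_cons_of_mem _ he)
  · exact h.isOpen_int.sdiff (isClosed_closedTri a b c)
  · exact h.bounded_int.subset Set.sdiff_subset
  · exact fun hb => h.unbounded_ext (hb.subset Set.subset_union_left)
  · rintro x ⟨hxI, hxT⟩ (hx | ⟨x0, x1, x2⟩)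
    · exact h.disj x hxI hx
    · exact hxT ⟨x0, x1.le, x2.le⟩
  · intro x
    have tri : x ∈ closedTri a b c → x ∈ E ∪ baseTri a b c ∨
        ∃ e ∈ (a, c) :: (c, b) :: es, x ∈ segment ℝ e.1 e.2 := by
      rintro ⟨x0, x1, x2⟩
      rcases x1.eq_or_lt with h1 | h1
      · exact Or.inr ⟨(c, b), by simp, (seg2 x).2 ⟨h1.symm, x2, x0⟩⟩
      · rcases x2.eq_or_lt with h2 | h2
        · exact Or.inr ⟨(a, c), by simp, (seg1 x).2 ⟨h2.symm, x0, x1⟩⟩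
        · exact Or.inl (Or.inr ⟨x0, h1, h2⟩)
    rcases h.cover x with hx | hx | ⟨e, he, hx⟩
    · by_cases hT : x ∈ closedTri a b c
      · exact Or.inr (tri hT)
      · exact Or.inl ⟨hx, hT⟩
    · exact Or.inr (Or.inl (Or.inl hx))
    · rcases List.mem_cons.1 he with rfl | he
      · obtain ⟨x0, x1, x2⟩ := (seg0 x).1 hx
        exact Or.inr (tri ⟨x0.ge, x1, x2⟩)
      · exact Or.inr (Or.inr ⟨e, by simp [he], hx⟩)
  · rintro x ⟨hxI, hxT⟩ e he hx
    rcases List.mem_cons.1 he with rfl | he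
    · obtain ⟨x1, x2, x3⟩ := (seg1 x).1 hx
      exact hxT ⟨x2, x3, x1.ge⟩
    · rcases List.mem_cons.1 he with rfl | he
      · obtain ⟨x1, x2, x3⟩ := (seg2 x).1 hx
        exact hxT ⟨x3, x1.ge, x2⟩
      · exact h.int_notMem x hxI e (List.mem_cons_of_mem _ he) hx
  · have key : ∀ x ∈ E, x ∉ closedTri a b c := fun x hx hT => by
      rcases tri_I x hT with h0 | hI
      · exact h.ext_notMem x hx (a, b) (by simp) ((seg0 x).2 ⟨h0, hT.2⟩)
      · exact h.disj x hI hx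
    rintro x (hxE | ⟨h0, h1, h2⟩) e he hx
    · rcases List.mem_cons.1 he with rfl | he
      · obtain ⟨x1, x2, x3⟩ := (seg1 x).1 hx
        exact key x hxE ⟨x2, x3, x1.ge⟩
      · rcases List.mem_cons.1 he with rfl | he
        · obtain ⟨x1, x2, x3⟩ := (seg2 x).1 hx
          exact key x hxE ⟨x3, x1.ge, x2⟩
        · exact h.ext_notMem x hxE e (List.mem_cons_of_mem _ he) hx
    · rcases List.mem_cons.1 he with rfl | he
      · exact h2.ne' ((seg1 x).1 hx).1
      · rcases List.mem_cons.1 he with rfl | he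
        · exact h1.ne' ((seg2 x).1 hx).1
        · rcases tri_I x ⟨h0, h1.le, h2.le⟩ with h0 | hI
          · rcases base_es x h0 h1.le h2.le e he hx with ⟨rfl, -⟩ | ⟨rfl, -⟩
            · simp at h1
            · simp at h2
          · exact h.int_notMem x hI e (List.mem_cons_of_mem _ he) hx
  · intro e he x hx
    rcases List.mem_cons.1 he with rfl | he
    · rw [openSegment_symm] at hx
      obtain ⟨x0, x1, x2⟩ := orient_pos_of_mem_openSegment hc2 hx
      have e1 : ∀ᶠ y in 𝓝 x, 0 < orient a b y :=
        (isOpen_lt continuous_const (by fun_prop)).mem_nhds x1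
      have e2 : ∀ᶠ y in 𝓝 x, 0 < orient b c y :=
        (isOpen_lt continuous_const (by fun_prop)).mem_nhds x2
      filter_upwards [e1, e2] with y y1 y2 y3
      exact Or.inr ⟨y1.le, y2, by rw [orient_swap]; simpa using y3⟩
    · rcases List.mem_cons.1 he with rfl | he
      · rw [openSegment_symm] at hx
        obtain ⟨x0, x1, x2⟩ := orient_pos_of_mem_openSegment hc1 hx
        have e1 : ∀ᶠ y in 𝓝 x, 0 < orient c a y :=
          (isOpen_lt continuous_const (by fun_prop)).mem_nhds x1
        have e2 : ∀ᶠ y in 𝓝 x, 0 < orient a b y :=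
          (isOpen_lt continuous_const (by fun_prop)).mem_nhds x2
        filter_upwards [e1, e2] with y y1 y2 y3
        exact Or.inr ⟨y2.le, by rw [orient_swap]; simpa using y3, y1⟩
      · filter_upwards [hr e (List.mem_cons_of_mem _ he) x hx] with y hy hy'
        exact Or.inl (hy hy')

/-- Subdividing the edge `a b` at one of its interior points. -/
lemma Bounds.subdivide {a b : ℝ × ℝ} {es : List ((ℝ × ℝ) × (ℝ × ℝ))} {I E : Set (ℝ × ℝ)}
    (h : Bounds ((a, b) :: es) I E) (hr : RightOf ((a, b) :: es) E) {t : ℝ} (ht0 : 0 < t)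
    (ht1 : t < 1) :
    Bounds ((a, a + t • (b - a)) :: (a + t • (b - a), b) :: es) I E ∧
      RightOf ((a, a + t • (b - a)) :: (a + t • (b - a), b) :: es) E := by
  set w := a + t • (b - a) with hw
  have hab : a ≠ b := h.ne (a, b) (by simp)
  have hba : b - a ≠ 0 := sub_ne_zero.2 hab.symm
  have hinj : ∀ s r : ℝ, a + s • (b - a) = a + r • (b - a) → s = r := fun s r hsr =>
    smul_left_injective ℝ hba (add_left_cancel hsr)
  have par0 : ∀ x, x ∈ segment ℝ a b ↔ ∃ s : ℝ, 0 ≤ s ∧ s ≤ 1 ∧ x = a + s • (b - a) := fun x => by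
    rw [segment_eq_image']
    constructor
    · rintro ⟨s, ⟨h0, h1⟩, rfl⟩; exact ⟨s, h0, h1, rfl⟩
    · rintro ⟨s, h0, h1, rfl⟩; exact ⟨s, ⟨h0, h1⟩, rfl⟩
  have par1 : ∀ x, x ∈ segment ℝ a w ↔ ∃ s : ℝ, 0 ≤ s ∧ s ≤ t ∧ x = a + s • (b - a) := fun x => by
    rw [segment_eq_image']
    constructor
    · rintro ⟨s, ⟨h0, h1⟩, rfl⟩
      refine ⟨s * t, by positivity, by nlinarith, ?_⟩
      simp only [hw, add_sub_cancel_left, mul_smul]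
    · rintro ⟨s, h0, h1, rfl⟩
      refine ⟨s / t, ⟨by positivity, by rw [div_le_one ht0]; exact h1⟩, ?_⟩
      simp only [hw, add_sub_cancel_left, smul_smul]
      rw [div_mul_cancel₀ _ ht0.ne']
  have h1t : 0 < 1 - t := by linarith
  have hbw : b - w = (1 - t) • (b - a) := by rw [hw]; module
  have par2 : ∀ x, x ∈ segment ℝ w b ↔ ∃ s : ℝ, t ≤ s ∧ s ≤ 1 ∧ x = a + s • (b - a) := fun x => by
    rw [segment_eq_image']
    constructor
    · rintro ⟨s, ⟨h0, h1⟩, rfl⟩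
      refine ⟨t + s * (1 - t), by nlinarith, by nlinarith, ?_⟩
      simp only [hw]; module
    · rintro ⟨s, h0, h1, rfl⟩
      refine ⟨(s - t) / (1 - t), ⟨div_nonneg (by linarith) h1t.le, ?_⟩, ?_⟩
      · rw [div_le_one h1t]; linarith
      · change w + ((s - t) / (1 - t)) • (b - w) = _
        rw [hbw, smul_smul, div_mul_cancel₀ _ h1t.ne', hw]; module
  have haw : a ≠ w := fun hh => ht0.ne' (hinj t 0 (by rw [← hw, ← hh]; simp))
  have hwb : w ≠ b := fun hh => ht1.ne (hinj t 1 (by rw [← hw, hh]; simp))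
  have hp := List.pairwise_cons.1 h.pairwise
  have hn := h.nodup
  simp only [List.map_cons, List.nodup_cons] at hn
  have sub1 : ∀ x ∈ segment ℝ a w, x ∈ segment ℝ a b := fun x hx => by
    obtain ⟨s, h0, h1, rfl⟩ := (par1 x).1 hx
    exact (par0 _).2 ⟨s, h0, h1.trans ht1.le, rfl⟩
  have sub2 : ∀ x ∈ segment ℝ w b, x ∈ segment ℝ a b := fun x hx => by
    obtain ⟨s, h0, h1, rfl⟩ := (par2 x).1 hx
    exact (par0 _).2 ⟨s, ht0.le.trans h0, h1, rfl⟩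
  have osub : ∀ x, x ∈ openSegment ℝ a w ∨ x ∈ openSegment ℝ w b → x ∈ openSegment ℝ a b := by
    intro x hx
    rw [openSegment_eq_image'] at hx ⊢
    rw [openSegment_eq_image'] at hx
    rcases hx with ⟨s, ⟨h0, h1⟩, rfl⟩ | ⟨s, ⟨h0, h1⟩, rfl⟩
    · refine ⟨s * t, ⟨by positivity, by nlinarith⟩, ?_⟩
      simp only [hw, add_sub_cancel_left, mul_smul]
    · refine ⟨t + s * (1 - t), ⟨by nlinarith, by nlinarith⟩, ?_⟩
      simp only [hw]; module
  have or1 : ∀ y, orient a w y = t * orient a b y := fun y => by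
    simp only [hw, orient, Prod.fst_add, Prod.snd_add, Prod.smul_fst, Prod.smul_snd, smul_eq_mul,
      Prod.fst_sub, Prod.snd_sub]
    ring
  have or2 : ∀ y, orient w b y = (1 - t) * orient a b y := fun y => by
    simp only [hw, orient, Prod.fst_add, Prod.snd_add, Prod.smul_fst, Prod.smul_snd, smul_eq_mul,
      Prod.fst_sub, Prod.snd_sub]
    ring
  refine ⟨⟨?_, ?_, ?_, h.isOpen_int, h.isOpen_ext, h.bounded_int, h.preconnected_ext,
    h.unbounded_ext, h.disj, ?_, ?_, ?_⟩, ?_⟩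
  · rw [List.pairwise_cons, List.pairwise_cons]
    refine ⟨fun f hf x hx hx' => ?_, fun f hf x hx hx' => ?_, hp.2⟩
    · rcases List.mem_cons.1 hf with rfl | hf
      · obtain ⟨s, h0, h1, rfl⟩ := (par1 _).1 hx
        obtain ⟨r, h2, h3, hsr⟩ := (par2 _).1 hx'
        obtain rfl := hinj _ _ hsr
        obtain rfl : s = t := le_antisymm h1 h2
        exact Or.inl ⟨rfl, rfl⟩
      · rcases hp.1 f hf x (sub1 x hx) hx' with ⟨h1, h2⟩ | h'
        · exfalso
          obtain ⟨s, h3, h4, rfl⟩ := (par1 _).1 hx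
          have : s = 1 := hinj s 1 (by rw [h1]; simp)
          linarith
        · exact Or.inr h'
    · rcases hp.1 f hf x (sub2 x hx) hx' with h' | ⟨h1, h2⟩
      · exact Or.inl h'
      · exfalso
        obtain ⟨s, h3, h4, rfl⟩ := (par2 _).1 hx
        have : s = 0 := hinj s 0 (by rw [h1]; simp)
        linarith
  · simp only [List.map_cons, List.nodup_cons, List.mem_cons, not_or]
    refine ⟨⟨haw, hn.1⟩, ?_, hn.2⟩
    intro hmem
    obtain ⟨f, hf, hfc⟩ := List.mem_map.1 hmem
    rcases hp.1 f hf w (sub1 w (right_mem_segment ℝ a w))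
      (hfc ▸ left_mem_segment ℝ f.1 f.2) with ⟨h1, -⟩ | ⟨h1, -⟩
    · exact hwb h1
    · exact haw h1.symm
  · intro e he
    rcases List.mem_cons.1 he with rfl | he
    · exact haw
    · rcases List.mem_cons.1 he with rfl | he
      · exact hwb
      · exact h.ne e (List.mem_cons_of_mem _ he)
  · intro x
    rcases h.cover x with hx | hx | ⟨e, he, hx⟩
    · exact Or.inl hx
    · exact Or.inr (Or.inl hx)
    · rcases List.mem_cons.1 he with rfl | he
      · obtain ⟨s, h0, h1, rfl⟩ := (par0 x).1 hx
        rcases le_total s t with hst | hst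
        · exact Or.inr (Or.inr ⟨(a, w), by simp, (par1 _).2 ⟨s, h0, hst, rfl⟩⟩)
        · exact Or.inr (Or.inr ⟨(w, b), by simp, (par2 _).2 ⟨s, hst, h1, rfl⟩⟩)
      · exact Or.inr (Or.inr ⟨e, by simp [he], hx⟩)
  · intro x hxI e he hx
    rcases List.mem_cons.1 he with rfl | he
    · exact h.int_notMem x hxI (a, b) (by simp) (sub1 x hx)
    · rcases List.mem_cons.1 he with rfl | he
      · exact h.int_notMem x hxI (a, b) (by simp) (sub2 x hx)
      · exact h.int_notMem x hxI e (List.mem_cons_of_mem _ he) hx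
  · intro x hxI e he hx
    rcases List.mem_cons.1 he with rfl | he
    · exact h.ext_notMem x hxI (a, b) (by simp) (sub1 x hx)
    · rcases List.mem_cons.1 he with rfl | he
      · exact h.ext_notMem x hxI (a, b) (by simp) (sub2 x hx)
      · exact h.ext_notMem x hxI e (List.mem_cons_of_mem _ he) hx
  · intro e he x hx
    rcases List.mem_cons.1 he with rfl | he
    · filter_upwards [hr (a, b) (by simp) x (osub x (Or.inl hx))] with y hy hy'
      simp only [or1] at hy'
      exact hy (by nlinarith)
    · rcases List.mem_cons.1 he with rfl | he
      · filter_upwards [hr (a, b) (by simp) x (osub x (Or.inr hx))] with y hy hy'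
        simp only [or2] at hy'
        exact hy (by nlinarith)
      · exact hr e (List.mem_cons_of_mem _ he) x hx

/-- The open triangle with counterclockwise vertices `a b c`. -/
def openTri (a b c : ℝ × ℝ) : Set (ℝ × ℝ) :=
  {x | 0 < orient a b x ∧ 0 < orient b c x ∧ 0 < orient c a x}

lemma isOpen_openTri (a b c : ℝ × ℝ) : IsOpen (openTri a b c) :=
  (isOpen_lt continuous_const (continuous_orient (by fun_prop) (by fun_prop) continuous_id)).inter
    ((isOpen_lt continuous_const
      (continuous_orient (by fun_prop) (by fun_prop) continuous_id)).inter
      (isOpen_lt continuous_const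
        (continuous_orient (by fun_prop) (by fun_prop) continuous_id)))

lemma edgeRel_of_orient_pos {a b c : ℝ × ℝ} (h : 0 < orient a b c) : EdgeRel (a, b) (b, c) := by
  intro x hx hx'
  have h1 := ((mem_segment_iff h).1 hx).1
  have h2 := ((mem_segment_iff (show 0 < orient b c a by rwa [orient_rotate])).1 hx').1
  have hb := orient_barycentric a b c x
  have hs := orient_sum a b c x
  rw [h1, h2] at hb hs
  simp only [zero_smul, zero_add, add_zero] at hb hs
  rw [hs] at hb
  have := smul_right_injective _ h.ne' hb
  exact Or.inl ⟨this, this⟩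

/-- A triangle bounds its open triangle. -/
lemma bounds_triangle {a b c : ℝ × ℝ} (h : 0 < orient a b c)
    (hb : Bornology.IsBounded (closedTri a b c)) :
    Bounds [(a, b), (b, c), (c, a)] (openTri a b c) (closedTri a b c)ᶜ ∧
      RightOf [(a, b), (b, c), (c, a)] (closedTri a b c)ᶜ := by
  obtain ⟨hab, hbc, hca⟩ := ne_of_orient_pos h
  have h1 : 0 < orient b c a := by rwa [orient_rotate]
  have h2 : 0 < orient c a b := by rwa [orient_rotate, orient_rotate]
  have hsub : openTri a b c ⊆ closedTri a b c := fun x hx => ⟨hx.1.le, hx.2.1.le, hx.2.2.le⟩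
  have hcv : ∀ p q : ℝ × ℝ, Convex ℝ {x | orient p q x < 0} := fun p q => by
    convert convex_orient_pos q p using 2
    ext x
    rw [orient_swap]
    simp
  have hE : (closedTri a b c)ᶜ =
      {x | orient a b x < 0} ∪ {x | orient b c x < 0} ∪ {x | orient c a x < 0} := by
    ext x
    simp only [closedTri, Set.mem_compl_iff, Set.mem_ofPred_eq, Set.mem_union, not_and_or, not_le,
      or_assoc]
  refine ⟨⟨?_, ?_, ?_, isOpen_openTri a b c, (isClosed_closedTri a b c).isOpen_compl,
    hb.subset hsub, ?_, ?_, fun x hx => not_not.2 (hsub hx), ?_, ?_, ?_⟩, ?_⟩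
  · simp only [List.pairwise_cons, List.mem_cons, List.not_mem_nil, or_false, forall_eq_or_imp,
      forall_eq, List.Pairwise.nil, and_true, IsEmpty.forall_iff, implies_true]
    exact ⟨⟨edgeRel_of_orient_pos h, (edgeRel_of_orient_pos h2).symm⟩, edgeRel_of_orient_pos h1⟩
  · simp [hab, hbc, hca.symm]
  · simp [hab, hbc, hca]
  · have apex : ∀ p q r : ℝ × ℝ, orient p q (3 • q - p - r) = - orient p q r ∧
        orient q r (3 • q - p - r) = - orient p q r := fun p q r => by
      constructor <;> simp [orient] <;> ring
    rw [hE]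
    refine IsPreconnected.union (3 • c - b - a) (Or.inr ?_) ?_
      (IsPreconnected.union (3 • b - a - c) ?_ ?_ (hcv _ _).isPreconnected
        (hcv _ _).isPreconnected) (hcv _ _).isPreconnected
    · show orient b c _ < 0
      rw [(apex b c a).1]; linarith
    · show orient c a _ < 0
      rw [(apex b c a).2]; linarith
    · show orient a b _ < 0
      rw [(apex a b c).1]; linarith
    · show orient b c _ < 0
      rw [(apex a b c).2]; linarith
  · intro hE'
    have := hE'.union hb
    rw [Set.compl_union_self] at this
    exact NormedSpace.unbounded_univ ℝ (ℝ × ℝ) this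
  · intro x
    by_cases hx : x ∈ closedTri a b c
    · obtain ⟨x0, x1, x2⟩ := hx
      rcases x0.eq_or_lt with y0 | y0
      · exact Or.inr (Or.inr ⟨(a, b), by simp, (mem_segment_iff h).2 ⟨y0.symm, x1, x2⟩⟩)
      rcases x1.eq_or_lt with y1 | y1
      · exact Or.inr (Or.inr ⟨(b, c), by simp, (mem_segment_iff h1).2 ⟨y1.symm, x2, x0⟩⟩)
      rcases x2.eq_or_lt with y2 | y2
      · exact Or.inr (Or.inr ⟨(c, a), by simp, (mem_segment_iff h2).2 ⟨y2.symm, x0, x1⟩⟩)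
      exact Or.inl ⟨y0, y1, y2⟩
    · exact Or.inr (Or.inl hx)
  · rintro x ⟨x0, x1, x2⟩ e he hx
    simp only [List.mem_cons, List.not_mem_nil, or_false] at he
    rcases he with rfl | rfl | rfl
    · exact x0.ne' ((mem_segment_iff h).1 hx).1
    · exact x1.ne' ((mem_segment_iff h1).1 hx).1
    · exact x2.ne' ((mem_segment_iff h2).1 hx).1
  · rintro x hxE e he hx
    simp only [List.mem_cons, List.not_mem_nil, or_false] at he
    rcases he with rfl | rfl | rfl
    · obtain ⟨x0, x1, x2⟩ := (mem_segment_iff h).1 hx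
      exact hxE ⟨x0.ge, x1, x2⟩
    · obtain ⟨x0, x1, x2⟩ := (mem_segment_iff h1).1 hx
      exact hxE ⟨x2, x0.ge, x1⟩
    · obtain ⟨x0, x1, x2⟩ := (mem_segment_iff h2).1 hx
      exact hxE ⟨x1, x2, x0.ge⟩
  · intro e he x _
    simp only [List.mem_cons, List.not_mem_nil, or_false] at he
    rcases he with rfl | rfl | rfl
    · exact Filter.Eventually.of_forall fun y hy hy' => hy.not_ge hy'.1
    · exact Filter.Eventually.of_forall fun y hy hy' => hy.not_ge hy'.2.1
    · exact Filter.Eventually.of_forall fun y hy hy' => hy.not_ge hy'.2.2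

lemma Bounds.mem_interior {es : List (Pt × Pt)} {I E : Set Pt} (h : Bounds es I E)
    (P : SimplePolygon) (hP : ∀ x, x ∈ P.boundary ↔ ∃ e ∈ es, x ∈ segment ℝ e.1 e.2) {x : Pt}
    (hx : x ∈ I) : x ∈ P.interior := by
  have hxb : x ∉ P.boundary := fun hb => by
    obtain ⟨e, he, hxe⟩ := (hP x).1 hb
    exact h.int_notMem x hx e he hxe
  refine ⟨hxb, h.bounded_int.subset ?_⟩
  refine isPreconnected_connectedComponentIn.subset_left_of_subset_union h.isOpen_int h.isOpen_ext
    (Set.disjoint_left.2 h.disj) ?_ ⟨x, mem_connectedComponentIn hxb, hx⟩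
  intro y hy
  have hyb := connectedComponentIn_subset _ _ hy
  rcases h.cover y with hy | hy | hy
  · exact Or.inl hy
  · exact Or.inr hy
  · exact absurd ((hP y).2 hy) hyb

lemma Bounds.notMem_region {es : List (Pt × Pt)} {I E : Set Pt} (h : Bounds es I E)
    (P : SimplePolygon) (hP : ∀ x, x ∈ P.boundary ↔ ∃ e ∈ es, x ∈ segment ℝ e.1 e.2) {x : Pt}
    (hx : x ∈ E) : x ∉ P.region := by
  have hEb : E ⊆ P.boundaryᶜ := fun y hy hb => by
    obtain ⟨e, he, hxe⟩ := (hP y).1 hb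
    exact h.ext_notMem y hy e he hxe
  rintro (hb | ⟨-, hb⟩)
  · exact hEb hx hb
  · exact h.unbounded_ext
      (hb.subset (h.preconnected_ext.subset_connectedComponentIn hx hEb))

/-- A list of vertices whose cyclic edges form a simple closed curve gives a simple polygon. -/
lemma Bounds.exists_simplePolygon {l : List Pt} {I E : Set Pt} (hl : 3 ≤ l.length)
    (h : Bounds (l.zip (l.rotate 1)) I E) :
    ∃ P : SimplePolygon, P.n = l.length ∧ (∀ i, P.vtx i = l.getD (i % l.length) 0) ∧
      (∀ x ∈ I, x ∈ P.interior) ∧ ∀ x ∈ E, x ∉ P.region := by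
  set n := l.length with hn
  have hn0 : 0 < n := by omega
  set v : ℕ → Pt := fun i => l.getD (i % n) 0 with hv
  have hvl : ∀ i (hi : i < n), v i = l[i] := fun i hi => by
    simp only [hv, Nat.mod_eq_of_lt hi]
    exact List.getD_eq_getElem _ _ hi
  have hlen : (l.zip (l.rotate 1)).length = n := by simp [hn]
  have hedge : ∀ i (hi : i < n), (l.zip (l.rotate 1))[i]'(by omega) = (v i, v (i + 1)) := by
    intro i hi
    have hm : (i + 1) % n < n := Nat.mod_lt _ hn0
    rw [List.getElem_zip, List.getElem_rotate, hvl i hi]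
    congr 1
    simp only [hv]
    rw [List.getD_eq_getElem _ _ hm]
  have hmem : ∀ e, e ∈ l.zip (l.rotate 1) ↔ ∃ i < n, e = (v i, v (i + 1)) := by
    intro e
    rw [List.mem_iff_getElem]
    constructor
    · rintro ⟨i, hi, rfl⟩
      exact ⟨i, by omega, hedge i (by omega)⟩
    · rintro ⟨i, hi, rfl⟩
      exact ⟨i, by omega, hedge i hi⟩
  have hnd : l.Nodup := by
    have := h.nodup
    rwa [List.map_fst_zip (by simp)] at this
  have hinj : ∀ i < n, ∀ j < n, v i = v j → i = j := by
    intro i hi j hj hij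
    rw [hvl i hi, hvl j hj] at hij
    exact (hnd.getElem_inj_iff).1 hij
  have hrel : ∀ i < n, ∀ j < n, i ≠ j → EdgeRel (v i, v (i + 1)) (v j, v (j + 1)) := by
    have key : ∀ i j, i < j → j < n → EdgeRel (v i, v (i + 1)) (v j, v (j + 1)) := by
      intro i j hij hj
      have := List.pairwise_iff_getElem.1 h.pairwise i j (by omega) (by omega) hij
      rwa [hedge i (by omega), hedge j hj] at this
    intro i hi j hj hij
    rcases lt_or_gt_of_ne hij with h' | h'
    · exact key i j h' hj
    · exact (key j i h' hi).symm
  have hfin : ∀ x : Pt, {i | i < n ∧ x ∈ segment ℝ (v i) (v (i + 1))}.Finite := fun x =>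
    (Set.finite_lt_nat n).subset fun i hi => hi.1
  let P : SimplePolygon :=
    { n := n
      three_le := hl
      vtx := v
      periodic := fun i => by simp [hv]
      inj := hinj
      simple := fun x => by
        by_contra! hcon
        obtain ⟨i, j, k, ⟨hi, hxi⟩, ⟨hj, hxj⟩, ⟨hk, hxk⟩, hij, hik, hjk⟩ :=
          (Set.two_lt_ncard_iff (hfin x)).1 hcon
        have src : ∀ p < n, ∀ q < n, p ≠ q → x = v p → x = v q → False :=
          fun p hp q hq hpq h1 h2 => hpq (hinj p hp q hq (h1 ▸ h2))
        rcases hrel i hi j hj hij x hxi hxj with ⟨h1, h2⟩ | ⟨h1, h2⟩ <;>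
        rcases hrel j hj k hk hjk x hxj hxk with ⟨h3, h4⟩ | ⟨h3, h4⟩ <;>
        rcases hrel i hi k hk hik x hxi hxk with ⟨h5, h6⟩ | ⟨h5, h6⟩ <;>
        first
          | exact src j hj k hk hjk (by assumption) (by assumption)
          | exact src i hi k hk hik (by assumption) (by assumption)
          | exact src i hi j hj hij (by assumption) (by assumption)
      vtx_of_two := fun x hx => by
        obtain ⟨i, j, hij, hs⟩ := Set.ncard_eq_two.1 hx
        have hi : i ∈ {i | i < n ∧ x ∈ segment ℝ (v i) (v (i + 1))} := hs ▸ Set.mem_insert i {j}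
        have hj : j ∈ {i | i < n ∧ x ∈ segment ℝ (v i) (v (i + 1))} :=
          hs ▸ Set.mem_insert_of_mem i rfl
        rcases hrel i hi.1 j hj.1 hij x hi.2 hj.2 with ⟨-, h2⟩ | ⟨h1, -⟩
        · exact ⟨j, hj.1, h2⟩
        · exact ⟨i, hi.1, h1⟩ }
  have hP : ∀ x, x ∈ P.boundary ↔ ∃ e ∈ l.zip (l.rotate 1), x ∈ segment ℝ e.1 e.2 := by
    intro x
    simp only [SimplePolygon.boundary, Set.mem_iUnion, Finset.mem_range, hmem]
    constructor
    · rintro ⟨i, hi, hx⟩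
      exact ⟨_, ⟨i, hi, rfl⟩, hx⟩
    · rintro ⟨e, ⟨i, hi, rfl⟩, hx⟩
      exact ⟨i, hi, hx⟩
  exact ⟨P, rfl, fun i => rfl, fun x hx => h.mem_interior P hP hx,
    fun x hx => h.notMem_region P hP hx⟩

lemma isBounded_image_homeomorph {V W : Type*} [NormedAddCommGroup V] [ProperSpace V]
    [NormedAddCommGroup W] (f : V ≃ₜ W) {s : Set V} (hs : Bornology.IsBounded s) :
    Bornology.IsBounded (f '' s) :=
  ((hs.isCompact_closure.image f.continuous).isBounded).subset (Set.image_mono subset_closure)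

/-- Transport of the bounding curve along a homeomorphism preserving segments. -/
lemma Bounds.map {V W : Type*} [NormedAddCommGroup V] [NormedSpace ℝ V] [ProperSpace V]
    [NormedAddCommGroup W] [NormedSpace ℝ W] [ProperSpace W] {es : List (V × V)} {I E : Set V}
    (h : Bounds es I E) (f : V ≃ₜ W)
    (hf : ∀ x a b, f x ∈ segment ℝ (f a) (f b) ↔ x ∈ segment ℝ a b) :
    Bounds (es.map (Prod.map f f)) (f '' I) (f '' E) where
  pairwise := by
    rw [List.pairwise_map]
    refine h.pairwise.imp fun {e e'} hee x hx hx' => ?_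
    obtain ⟨x, rfl⟩ := f.surjective x
    simp only [Prod.map_fst, Prod.map_snd, hf, f.injective.eq_iff] at *
    exact hee x hx hx'
  nodup := by
    have := h.nodup.map f.injective
    simpa [List.map_map, Function.comp_def] using this
  ne := by
    simp only [List.mem_map]
    rintro _ ⟨e, he, rfl⟩ hee
    exact h.ne e he (f.injective hee)
  isOpen_int := f.isOpenMap _ h.isOpen_int
  isOpen_ext := f.isOpenMap _ h.isOpen_ext
  bounded_int := isBounded_image_homeomorph f h.bounded_int
  preconnected_ext := h.preconnected_ext.image _ f.continuous.continuousOn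
  unbounded_ext hb := h.unbounded_ext (by
    have := isBounded_image_homeomorph f.symm hb
    rwa [← Set.image_comp, f.symm_comp_self, Set.image_id] at this)
  disj := by
    rintro _ ⟨x, hx, rfl⟩ ⟨y, hy, hxy⟩
    obtain rfl := f.injective hxy
    exact h.disj _ hx hy
  cover x := by
    obtain ⟨x, rfl⟩ := f.surjective x
    rcases h.cover x with h | h | ⟨e, he, hx⟩
    · exact Or.inl ⟨x, h, rfl⟩
    · exact Or.inr (Or.inl ⟨x, h, rfl⟩)
    · exact Or.inr (Or.inr ⟨_, List.mem_map_of_mem he, (hf _ _ _).2 hx⟩)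
  int_notMem := by
    simp only [List.mem_map]
    rintro _ ⟨x, hx, rfl⟩ _ ⟨e, he, rfl⟩ hxe
    exact h.int_notMem x hx e he ((hf _ _ _).1 hxe)
  ext_notMem := by
    simp only [List.mem_map]
    rintro _ ⟨x, hx, rfl⟩ _ ⟨e, he, rfl⟩ hxe
    exact h.ext_notMem x hx e he ((hf _ _ _).1 hxe)

/-- Reversing the direction of every edge. -/
lemma Bounds.swap {V : Type*} [NormedAddCommGroup V] [NormedSpace ℝ V] {es : List (V × V)}
    {I E : Set V} (h : Bounds es I E) (hnd : (es.map Prod.snd).Nodup) :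
    Bounds (es.map Prod.swap) I E where
  pairwise := by
    rw [List.pairwise_map]
    refine h.pairwise.imp fun {e f} hef x hx hx' => ?_
    simp only [Prod.fst_swap, Prod.snd_swap] at *
    rw [segment_symm] at hx hx'
    rcases hef x hx hx' with h | h
    · exact Or.inr h
    · exact Or.inl h
  nodup := by simpa [List.map_map, Function.comp_def] using hnd
  ne := by
    simp only [List.mem_map]
    rintro _ ⟨e, he, rfl⟩
    exact (h.ne e he).symm
  isOpen_int := h.isOpen_int
  isOpen_ext := h.isOpen_ext
  bounded_int := h.bounded_int
  preconnected_ext := h.preconnected_ext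
  unbounded_ext := h.unbounded_ext
  disj := h.disj
  cover x := by
    rcases h.cover x with h | h | ⟨e, he, hx⟩
    · exact Or.inl h
    · exact Or.inr (Or.inl h)
    · exact Or.inr (Or.inr ⟨e.swap, List.mem_map_of_mem he, by rwa [segment_symm] at hx⟩)
  int_notMem := by
    simp only [List.mem_map]
    rintro x hx _ ⟨e, he, rfl⟩ hxe
    rw [segment_symm] at hxe
    exact h.int_notMem x hx e he hxe
  ext_notMem := by
    simp only [List.mem_map]
    rintro x hx _ ⟨e, he, rfl⟩ hxe
    rw [segment_symm] at hxe
    exact h.ext_notMem x hx e he hxe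

/-- A triangle symmetric about the first axis. -/
lemma bounds_symm_triangle {L D : ℝ} (hL : 0 < L) (hD : 0 < D) :
    Bounds [((L, -D), (L, D)), ((L, D), (-L, 0)), ((-L, 0), (L, -D))]
      (openTri (L, -D) (L, D) (-L, 0)) (closedTri (L, -D) (L, D) (-L, 0))ᶜ ∧
    RightOf [((L, -D), (L, D)), ((L, D), (-L, 0)), ((-L, 0), (L, -D))]
      (closedTri (L, -D) (L, D) (-L, 0))ᶜ := by
  have hLD := mul_pos hL hD
  refine bounds_triangle (by simp only [orient]; nlinarith) ?_
  refine (Metric.isBounded_Icc ((-L, -D) : ℝ × ℝ) (L, D)).subset ?_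
  rintro ⟨x, y⟩ ⟨h1, h2, h3⟩
  simp only [orient] at h1 h2 h3
  have hx : x ≤ L := by nlinarith
  refine ⟨⟨?_, ?_⟩, hx, ?_⟩ <;> simp only <;> nlinarith

lemma mem_symm_openTri {L D x y : ℝ} (hD : 0 < D) (hx : x < L)
    (h1 : 2 * L * y < D * (L + x)) (h2 : -(2 * L * y) < D * (L + x)) :
    (x, y) ∈ openTri (L, -D) (L, D) (-L, 0) := by
  refine ⟨?_, ?_, ?_⟩ <;> simp only [orient] <;> nlinarith

lemma affine_pos_of_mem_closedTri {a b c x : ℝ × ℝ} (h : 0 < orient a b c)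
    (hx : x ∈ closedTri a b c) (A B C : ℝ) (ha : 0 < A * a.1 + B * a.2 + C)
    (hb : 0 < A * b.1 + B * b.2 + C) (hc : 0 < A * c.1 + B * c.2 + C) :
    0 < A * x.1 + B * x.2 + C := by
  obtain ⟨h1, h2, h3⟩ := hx
  have hs := orient_sum a b c x
  have key : orient a b c * (A * x.1 + B * x.2 + C) =
      orient b c x * (A * a.1 + B * a.2 + C) + orient c a x * (A * b.1 + B * b.2 + C) +
        orient a b x * (A * c.1 + B * c.2 + C) := by
    unfold orient; ring
  refine pos_of_mul_pos_right (a := orient a b c) ?_ h.le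
  rw [key]
  have k1 := mul_nonneg h2 ha.le
  have k2 := mul_nonneg h3 hb.le
  have k3 := mul_nonneg h1 hc.le
  rcases h1.eq_or_lt with e1 | e1
  · rcases h2.eq_or_lt with e2 | e2
    · have := mul_pos (show 0 < orient c a x by linarith) hb
      linarith
    · have := mul_pos e2 ha
      linarith
  · have := mul_pos e1 hc
    linarith

lemma orient_pos_of_mem_closedTri {a b c x p q : ℝ × ℝ} (h : 0 < orient a b c)
    (hx : x ∈ closedTri a b c) (ha : 0 < orient p q a) (hb : 0 < orient p q b)
    (hc : 0 < orient p q c) : 0 < orient p q x := by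
  have key (z : ℝ × ℝ) : orient p q z =
      (-(q.2 - p.2)) * z.1 + (q.1 - p.1) * z.2 + ((q.2 - p.2) * p.1 - (q.1 - p.1) * p.2) := by
    unfold orient; ring
  rw [key] at *
  exact affine_pos_of_mem_closedTri h hx _ _ _ ha hb hc

lemma closedTri_subset_openTri {a b c p q r : ℝ × ℝ} (h : 0 < orient a b c)
    (ha : a ∈ openTri p q r) (hb : b ∈ openTri p q r) (hc : c ∈ openTri p q r) :
    closedTri a b c ⊆ openTri p q r := fun _ hx =>
  ⟨orient_pos_of_mem_closedTri h hx ha.1 hb.1 hc.1,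
    orient_pos_of_mem_closedTri h hx ha.2.1 hb.2.1 hc.2.1,
    orient_pos_of_mem_closedTri h hx ha.2.2 hb.2.2 hc.2.2⟩

lemma orient_smul_right (a b c : ℝ × ℝ) (t : ℝ) :
    orient a (a + t • (b - a)) c = t * orient a b c := by
  simp only [orient, Prod.fst_add, Prod.snd_add, Prod.smul_fst, Prod.smul_snd, smul_eq_mul,
    Prod.fst_sub, Prod.snd_sub]
  ring

/-- A triangle with a wedge and then a thin spike removed. -/
lemma bounds_hexagon {L D T ε : ℝ} (hL : 0 < L) (hD : 0 < D) (hT : 0 < T) (hε : 0 < ε)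
    (hεL : ε < L) (hY : (-ε, T) ∈ openTri (L, -D) (L, D) (-L, 0)) :
    ∃ E, Bounds [((0, 0), (-ε, T)), ((-ε, T), (ε, ε * D / L)), ((ε, ε * D / L), (L, D)),
        ((L, D), (-L, 0)), ((-L, 0), (L, -D)), ((L, -D), (0, 0))]
      ((openTri (L, -D) (L, D) (-L, 0) \ closedTri (L, -D) (L, D) (0, 0)) \
        closedTri (0, 0) (ε, ε * D / L) (-ε, T)) E ∧
      RightOf [((0, 0), (-ε, T)), ((-ε, T), (ε, ε * D / L)), ((ε, ε * D / L), (L, D)),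
        ((L, D), (-L, 0)), ((-L, 0), (L, -D)), ((L, -D), (0, 0))] E ∧
      baseTri (L, -D) (L, D) (0, 0) ⊆ E ∧ baseTri (0, 0) (ε, ε * D / L) (-ε, T) ⊆ E := by
  have hLD := mul_pos hL hD
  obtain ⟨h, hr⟩ := bounds_symm_triangle hL hD
  have hO : ((0, 0) : ℝ × ℝ) ∈ openTri (L, -D) (L, D) (-L, 0) :=
    mem_symm_openTri hD hL (by nlinarith) (by nlinarith)
  have hw : ((ε, ε * D / L) : ℝ × ℝ) ∈ openTri (L, -D) (L, D) (-L, 0) :=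
    mem_symm_openTri hD hεL (by field_simp; nlinarith) (by field_simp; nlinarith)
  obtain ⟨h, hr⟩ := h.dent (c := (0, 0)) hr (by simp only [orient]; nlinarith) (by
    rintro ⟨x, y⟩ ⟨h1, h2, h3⟩ h0
    simp only [orient] at h0 h1 h2 h3
    have h2' : 0 ≤ D * x - L * y := by nlinarith
    have h3' : 0 ≤ D * x + L * y := by nlinarith
    have hx : x < L := by nlinarith
    have hx0 : 0 ≤ x := by nlinarith
    refine mem_symm_openTri hD hx ?_ ?_ <;> nlinarith)
  have hp : List.Perm [((L, -D), ((0, 0) : ℝ × ℝ)), ((0, 0), (L, D)), ((L, D), (-L, 0)),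
      ((-L, 0), (L, -D))] [((0, 0), (L, D)), ((L, D), (-L, 0)),
      ((-L, 0), (L, -D)), ((L, -D), ((0, 0) : ℝ × ℝ))] :=
    (List.rotate_perm _ 1).symm
  have h' := h.perm hp
  have hr' := hr.perm hp
  obtain ⟨h, hr⟩ := h'.subdivide hr' (t := ε / L) (by positivity) (by rwa [div_lt_one hL])
  have hwe : ((0, 0) : ℝ × ℝ) + (ε / L) • (((L, D) : ℝ × ℝ) - (0, 0)) = (ε, ε * D / L) := by
    ext <;> simp <;> field_simp
  rw [hwe] at h hr
  have hpos : 0 < orient (0, 0) (ε, ε * D / L) (-ε, T) := by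
    simp only [orient]; ring_nf; positivity
  obtain ⟨h, hr⟩ := h.dent (c := (-ε, T)) hr hpos (by
    intro x hx hx0
    refine ⟨closedTri_subset_openTri hpos hO hw hY hx, fun hx' => ?_⟩
    have := hx'.2.1
    rw [← hwe, orient_smul_right, orient_swap] at hx0
    have := pos_of_mul_pos_right hx0 (by positivity)
    linarith)
  refine ⟨_, h, hr, ?_, ?_⟩
  · exact fun x hx => Or.inl (Or.inr hx)
  · exact fun x hx => Or.inr hx

/-- There is a simple octagon with interior containing `R`, exterior containing `B`,
positive shoelace area, and three prescribed reflex vertices. -/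
def HasOctagon (B R : Set (ℝ × ℝ)) : Prop :=
  ∃ (a b c d e f g h : ℝ × ℝ) (I E : Set (ℝ × ℝ)),
    Bounds [(a, b), (b, c), (c, d), (d, e), (e, f), (f, g), (g, h), (h, a)] I E ∧
    R ⊆ I ∧ B ⊆ E ∧ orient a b c ≤ 0 ∧ orient c d e ≤ 0 ∧
    (orient b c d ≤ 0 ∨ orient d e f ≤ 0) ∧
    0 < orient 0 a b + orient 0 b c + orient 0 c d + orient 0 d e + orient 0 e f +
      orient 0 f g + orient 0 g h + orient 0 h a

/-- A point slightly beyond `b`, as seen from the midpoint of `p` and `q`. -/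
def overshoot (ε : ℝ) (b p q : ℝ × ℝ) : ℝ × ℝ := b + ε • (b - (1 / 2 : ℝ) • (p + q))

@[fun_prop]
lemma continuous_overshoot {X : Type*} [TopologicalSpace X] {k : X → ℝ} {f g h : X → ℝ × ℝ}
    (hk : Continuous k) (hf : Continuous f) (hg : Continuous g) (hh : Continuous h) :
    Continuous fun x => overshoot (k x) (f x) (g x) (h x) := by
  unfold overshoot; fun_prop

lemma overshoot_zero (b p q : ℝ × ℝ) : overshoot 0 b p q = b := by simp [overshoot]

lemma mem_baseTri_overshoot {b p q : ℝ × ℝ} {ε : ℝ} (hε : 0 < ε)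
    (h : 0 < orient p q (overshoot ε b p q)) : b ∈ baseTri p q (overshoot ε b p q) := by
  have h1 : orient p q (overshoot ε b p q) = (1 + ε) * orient p q b := by
    simp [orient, overshoot]; ring
  have h2 : orient q (overshoot ε b p q) b = ε / 2 * orient p q b := by
    simp [orient, overshoot]; ring
  have h3 : orient (overshoot ε b p q) p b = ε / 2 * orient p q b := by
    simp [orient, overshoot]; ring
  rw [h1] at h
  have := pos_of_mul_pos_right h (by positivity)
  refine ⟨this.le, ?_, ?_⟩
  · rw [h2]; positivity
  · rw [h3]; positivity

lemma eventually_pos_of_continuous {g : ℝ → ℝ} (hg : Continuous g) (h0 : 0 < g 0) :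
    ∀ᶠ ε in 𝓝[>] (0 : ℝ), 0 < g ε :=
  ((hg.tendsto 0).eventually (lt_mem_nhds h0)).filter_mono nhdsWithin_le_nhds

lemma eventually_mem_of_continuous {g : ℝ → ℝ × ℝ} (hg : Continuous g) {U : Set (ℝ × ℝ)}
    (hU : IsOpen U) (h0 : g 0 ∈ U) : ∀ᶠ ε in 𝓝[>] (0 : ℝ), g ε ∈ U :=
  ((hg.tendsto 0).eventually (hU.mem_nhds h0)).filter_mono nhdsWithin_le_nhds

/-- The data of the construction: a large triangle containing all points, a narrow wedge
around the first axis and a generic point on the second axis. -/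
structure Frame (R : Set (ℝ × ℝ)) (p q r s : ℝ) (b : ℝ × ℝ) (L D T : ℝ) : Prop where
  L_pos : 0 < L
  D_pos : 0 < D
  T_pos : 0 < T
  p_pos : 0 < p
  q_pos : 0 < q
  r_pos : 0 < r
  s_pos : 0 < s
  p_lt : p < L
  q_lt : q < L
  r_lt : 2 * r < T
  s_lt : 2 * s < T
  finite : R.Finite
  subset : R ⊆ openTri (L, -D) (L, D) (-L, 0)
  mem : b ∈ openTri (L, -D) (L, D) (-L, 0)
  top_mem : (0, T) ∈ openTri (L, -D) (L, D) (-L, 0)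
  wedge : ∀ x ∈ R, x ∉ closedTri (L, -D) (L, D) (0, 0)
  off_axis : ∀ x ∈ R, x.1 ≠ 0
  off_line : ∀ x ∈ R, orient (0, T) b x ≠ 0

lemma Frame.base_mem {R : Set (ℝ × ℝ)} {p q r s L D T : ℝ} {b : ℝ × ℝ}
    (F : Frame R p q r s b L D T) {x : ℝ} (h0 : 0 < x) (h1 : x < L) :
    (x, 0) ∈ baseTri (L, -D) (L, D) (0, 0) := by
  have := F.D_pos
  have := mul_pos this h0
  refine ⟨?_, ?_, ?_⟩ <;> simp only [orient] <;> nlinarith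

lemma Frame.spike_mem {R : Set (ℝ × ℝ)} {p q r s L D T : ℝ} {b : ℝ × ℝ}
    (F : Frame R p q r s b L D T) {x ε : ℝ} (h0 : 0 < x) (h1 : 2 * x < T) (hε : 0 < ε) :
    (0, x) ∈ baseTri (0, 0) (ε, ε * D / L) (-ε, T) := by
  have h2 := F.D_pos
  have h3 := F.L_pos
  have h4 := mul_pos hε h0
  have h5 : 0 < ε * D / L := by positivity
  have h6 := mul_pos hε h5
  have h7 := mul_pos hε (show 0 < T - 2 * x by linarith)
  refine ⟨?_, ?_, ?_⟩ <;> simp only [orient] <;> nlinarith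

/-- If the three vertices of a shrinking triangle tend to points of the line through `p` and
`q`, then the triangle eventually avoids any finite set off that line. -/
lemma eventually_notMem_closedTri {R : Set (ℝ × ℝ)} (hR : R.Finite) {p q : ℝ × ℝ}
    (h : ∀ x ∈ R, orient p q x ≠ 0) {f g k : ℝ → ℝ × ℝ} (hf : Continuous f)
    (hg : Continuous g) (hk : Continuous k) (hf0 : orient p q (f 0) = 0)
    (hg0 : orient p q (g 0) = 0) (hk0 : orient p q (k 0) = 0) :
    ∀ᶠ ε in 𝓝[>] (0 : ℝ), 0 < orient (f ε) (g ε) (k ε) →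
      ∀ x ∈ R, x ∉ closedTri (f ε) (g ε) (k ε) := by
  have main (p q : ℝ × ℝ) (hf0 : orient p q (f 0) = 0) (hg0 : orient p q (g 0) = 0)
      (hk0 : orient p q (k 0) = 0) (x : ℝ × ℝ) (hx : orient p q x < 0) :
      ∀ᶠ ε in 𝓝[>] (0 : ℝ), 0 < orient (f ε) (g ε) (k ε) →
        x ∉ closedTri (f ε) (g ε) (k ε) := by
    have key (v : ℝ × ℝ) : orient p q v - orient p q x = (-(q.2 - p.2)) * v.1 +
        (q.1 - p.1) * v.2 + ((q.2 - p.2) * p.1 - (q.1 - p.1) * p.2 - orient p q x) := by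
      unfold orient; ring
    have e (j : ℝ → ℝ × ℝ) (hj : Continuous j) (hj0 : orient p q (j 0) = 0) :
        ∀ᶠ ε in 𝓝[>] (0 : ℝ), 0 < orient p q (j ε) - orient p q x :=
      eventually_pos_of_continuous (by fun_prop) (by rw [hj0]; linarith)
    filter_upwards [e f hf hf0, e g hg hg0, e k hk hk0] with ε h1 h2 h3 hpos hmem
    rw [key] at h1 h2 h3
    have := affine_pos_of_mem_closedTri hpos hmem _ _ _ h1 h2 h3
    rw [← key, sub_self] at this
    exact this.false
  have neg (x : ℝ × ℝ) : orient p q x = 0 → orient q p x = 0 := fun hx => by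
    rw [orient_swap, hx, neg_zero]
  have all : ∀ x ∈ R, ∀ᶠ ε in 𝓝[>] (0 : ℝ), 0 < orient (f ε) (g ε) (k ε) →
      x ∉ closedTri (f ε) (g ε) (k ε) := by
    intro x hx
    rcases (h x hx).lt_or_gt with h0 | h0
    · exact main p q hf0 hg0 hk0 x h0
    · exact main q p (neg _ hf0) (neg _ hg0) (neg _ hk0) x (by rw [orient_swap]; linarith)
  filter_upwards [hR.eventually_all.2 all] with ε hε hpos x hx using hε x hx hpos

lemma Frame.eventually_spike {R : Set (ℝ × ℝ)} {p q r s L D T : ℝ} {b : ℝ × ℝ}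
    (F : Frame R p q r s b L D T) :
    ∀ᶠ ε in 𝓝[>] (0 : ℝ), ∀ x ∈ R, x ∉ closedTri (0, 0) (ε, ε * D / L) (-ε, T) := by
  have hpos : ∀ᶠ ε in 𝓝[>] (0 : ℝ), 0 < ε := eventually_mem_nhdsWithin
  have h1 := F.L_pos
  have h2 := F.D_pos
  have h3 := F.T_pos
  filter_upwards [hpos, eventually_notMem_closedTri F.finite (p := (0, 0)) (q := (0, 1))
    (f := fun _ => (0, 0)) (g := fun ε => (ε, ε * D / L)) (k := fun ε => (-ε, T))
    (fun x hx h0 => F.off_axis x hx (by simpa [orient] using h0)) (by fun_prop) (by fun_prop)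
    (by fun_prop) (by simp [orient]) (by simp [orient]) (by simp [orient])] with ε hε h
  refine h ?_
  simp only [orient]; ring_nf; positivity

lemma Frame.hasOctagon_of_pos {R : Set (ℝ × ℝ)} {p q r s α β L D T : ℝ}
    (F : Frame R p q r s (α, β) L D T) (hα : 0 < α) (hβ : D * α < L * β) :
    HasOctagon {(p, 0), (q, 0), (0, r), (0, s), (α, β)} R := by
  have hL := F.L_pos
  have hD := F.D_pos
  have hT := F.T_pos
  let w : ℝ → ℝ × ℝ := fun ε => (ε, ε * D / L)
  let y : ℝ → ℝ × ℝ := fun ε => (-ε, T)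
  let z : ℝ → ℝ × ℝ := fun ε => y ε + ε • (w ε - y ε)
  let c : ℝ → ℝ × ℝ := fun ε => overshoot ε (α, β) (y ε) (z ε)
  have cw : Continuous w := by fun_prop
  have cy : Continuous y := by fun_prop
  have cz : Continuous z := by fun_prop
  have cc : Continuous c := by fun_prop
  have w0 : w 0 = (0, 0) := by simp [w]
  have y0 : y 0 = (0, T) := by simp [y]
  have z0 : z 0 = (0, T) := by simp [z, y0]
  have c0 : c 0 = (α, β) := overshoot_zero _ _ _
  have wedge (v : ℝ → ℝ × ℝ) (hv : Continuous v) (h0 : 0 < orient (0, 0) (L, D) (v 0)) :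
      ∀ᶠ ε in 𝓝[>] (0 : ℝ), 0 < orient (0, 0) (L, D) (v ε) :=
    eventually_pos_of_continuous (by fun_prop) h0
  have inside (v : ℝ → ℝ × ℝ) (hv : Continuous v)
      (h0 : v 0 ∈ openTri (L, -D) (L, D) (-L, 0)) :
      ∀ᶠ ε in 𝓝[>] (0 : ℝ), v ε ∈ openTri (L, -D) (L, D) (-L, 0) :=
    eventually_mem_of_continuous hv (isOpen_openTri _ _ _) h0
  have hTop : 0 < orient (0, 0) (L, D) (0, T) := by simp [orient]; positivity
  have hpos : ∀ᶠ ε in 𝓝[>] (0 : ℝ), 0 < ε := eventually_mem_nhdsWithin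
  have hsmall (k : ℝ) (hk : 0 < k) : ∀ᶠ ε in 𝓝[>] (0 : ℝ), 0 < k - ε :=
    eventually_pos_of_continuous (by fun_prop) (by simpa)
  have hev := (((((((hpos.and (hsmall 1 one_pos)).and (hsmall L hL)).and
    (inside y cy (by rw [y0]; exact F.top_mem))).and
    (inside z cz (by rw [z0]; exact F.top_mem))).and
    (inside c cc (by rw [c0]; exact F.mem))).and
    ((wedge y cy (by rwa [y0])).and ((wedge z cz (by rwa [z0])).and
      (wedge c cc (by rw [c0]; simp [orient]; linarith))))).and
    (F.eventually_spike.and (eventually_notMem_closedTri F.finite F.off_line cy cz cc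
      (by simp [y0]) (by simp [z0]) (by simp [c0])))).and
    ((((eventually_pos_of_continuous (g := fun ε => orient (y ε) (w ε) (c ε)) (by fun_prop)
      (by rw [y0, w0, c0]; simp [orient]; positivity)).and
    (eventually_pos_of_continuous (g := fun ε => -orient (L, -D) (0, 0) (y ε)) (by fun_prop)
      (by rw [y0]; simp [orient]; nlinarith))).and
    (eventually_pos_of_continuous (g := fun ε => -orient (0, 0) (y ε) (c ε)) (by fun_prop)
      (by rw [y0, c0]; simp [orient]; positivity))).and
    (eventually_pos_of_continuous (g := fun ε => orient 0 (L, -D) (0, 0) +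
      orient 0 (0, 0) (y ε) + orient 0 (y ε) (c ε) + orient 0 (c ε) (z ε) +
      orient 0 (z ε) (w ε) + orient 0 (w ε) (L, D) + orient 0 (L, D) (-L, 0) +
      orient 0 (-L, 0) (L, -D)) (by fun_prop)
      (by rw [y0, c0, z0, w0]; simp [orient]; nlinarith)))
  obtain ⟨ε, ⟨⟨⟨⟨⟨⟨⟨hε, hε1⟩, hεL⟩, hyI⟩, hzI⟩, hcI⟩, hyW, hzW, hcW⟩, hRs, hRt⟩,
    ⟨⟨hywc, hUOy⟩, hOyc⟩, harea⟩ := hev.exists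
  have hyzc : 0 < orient (y ε) (z ε) (c ε) := by
    rw [orient_smul_right]; positivity
  obtain ⟨E, h, hr, hE1, hE2⟩ := bounds_hexagon hL hD hT hε (by linarith) hyI
  replace h := h.perm (List.rotate_perm _ 1).symm
  replace hr := hr.perm (List.rotate_perm _ 1).symm
  obtain ⟨h, hr⟩ := Bounds.subdivide (a := y ε) (b := w ε) h hr hε (by linarith)
  obtain ⟨h, hr⟩ := Bounds.dent (a := y ε) (b := z ε) (c := c ε) h hr hyzc (by
    intro x hx hx0
    refine ⟨⟨closedTri_subset_openTri hyzc hyI hzI hcI hx, fun hx' => ?_⟩, fun hx' => ?_⟩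
    · have h1 := orient_pos_of_mem_closedTri hyzc hx hyW hzW hcW
      have h2 := hx'.2.1
      rw [orient_swap] at h2
      linarith
    · rw [orient_smul_right] at hx0
      have h1 := pos_of_mul_pos_right hx0 hε.le
      have h2 := hx'.2.1
      rw [orient_swap] at h2
      linarith)
  refine ⟨(L, -D), (0, 0), y ε, c ε, z ε, w ε, (L, D), (-L, 0), _, _,
    h.perm (List.rotate_perm _ 6).symm, ?_, ?_, by linarith, ?_, Or.inl (by linarith), harea⟩
  · exact fun x hx => ⟨⟨⟨F.subset hx, F.wedge x hx⟩, hRs x hx⟩, hRt hyzc x hx⟩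
  · rintro x (rfl | rfl | rfl | rfl | rfl)
    · exact Or.inl (hE1 (F.base_mem F.p_pos F.p_lt))
    · exact Or.inl (hE1 (F.base_mem F.q_pos F.q_lt))
    · exact Or.inl (hE2 (F.spike_mem F.r_pos F.r_lt hε))
    · exact Or.inl (hE2 (F.spike_mem F.s_pos F.s_lt hε))
    · exact Or.inr (mem_baseTri_overshoot hε hyzc)
  · have : orient (y ε) (c ε) (z ε) = -orient (y ε) (z ε) (c ε) := by unfold orient; ring
    linarith

lemma Frame.hasOctagon_of_neg {R : Set (ℝ × ℝ)} {p q r s α β L D T : ℝ}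
    (F : Frame R p q r s (α, β) L D T) (hα : α < 0) :
    HasOctagon {(p, 0), (q, 0), (0, r), (0, s), (α, β)} R := by
  have hL := F.L_pos
  have hD := F.D_pos
  have hT := F.T_pos
  have hαT := mul_pos (neg_pos.2 hα) hT
  let w : ℝ → ℝ × ℝ := fun ε => (ε, ε * D / L)
  let y : ℝ → ℝ × ℝ := fun ε => (-ε, T)
  let z : ℝ → ℝ × ℝ := fun ε => (0, 0) + (1 - ε) • (y ε - (0, 0))
  let c : ℝ → ℝ × ℝ := fun ε => overshoot ε (α, β) (z ε) (y ε)
  have cw : Continuous w := by fun_prop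
  have cy : Continuous y := by fun_prop
  have cz : Continuous z := by fun_prop
  have cc : Continuous c := by fun_prop
  have w0 : w 0 = (0, 0) := by simp [w]
  have y0 : y 0 = (0, T) := by simp [y]
  have z0 : z 0 = (0, T) := by simp [z, y0]
  have c0 : c 0 = (α, β) := overshoot_zero _ _ _
  have inside (v : ℝ → ℝ × ℝ) (hv : Continuous v)
      (h0 : v 0 ∈ openTri (L, -D) (L, D) (-L, 0)) :
      ∀ᶠ ε in 𝓝[>] (0 : ℝ), v ε ∈ openTri (L, -D) (L, D) (-L, 0) :=
    eventually_mem_of_continuous hv (isOpen_openTri _ _ _) h0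
  have hpos : ∀ᶠ ε in 𝓝[>] (0 : ℝ), 0 < ε := eventually_mem_nhdsWithin
  have hsmall (k : ℝ) (hk : 0 < k) : ∀ᶠ ε in 𝓝[>] (0 : ℝ), 0 < k - ε :=
    eventually_pos_of_continuous (by fun_prop) (by simpa)
  have hev := (((((((hpos.and (hsmall 1 one_pos)).and (hsmall L hL)).and
    (inside y cy (by rw [y0]; exact F.top_mem))).and
    (inside z cz (by rw [z0]; exact F.top_mem))).and
    (inside c cc (by rw [c0]; exact F.mem))).and
    (eventually_pos_of_continuous (g := fun ε => -(c ε).1) (by fun_prop)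
      (by rw [c0]; simpa))).and
    (F.eventually_spike.and (eventually_notMem_closedTri F.finite F.off_line cz cy cc
      (by simp [z0]) (by simp [y0]) (by simp [c0])))).and
    ((((eventually_pos_of_continuous (g := fun ε => orient (0, 0) (y ε) (c ε)) (by fun_prop)
      (by rw [y0, c0]; simp [orient]; nlinarith)).and
    (eventually_pos_of_continuous (g := fun ε => -orient (L, -D) (0, 0) (z ε)) (by fun_prop)
      (by rw [z0]; simp [orient]; nlinarith))).and
    (eventually_pos_of_continuous (g := fun ε => -orient (c ε) (y ε) (w ε)) (by fun_prop)
      (by rw [y0, c0, w0]; simp [orient]; nlinarith))).and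
    (eventually_pos_of_continuous (g := fun ε => orient 0 (L, -D) (0, 0) +
      orient 0 (0, 0) (z ε) + orient 0 (z ε) (c ε) + orient 0 (c ε) (y ε) +
      orient 0 (y ε) (w ε) + orient 0 (w ε) (L, D) + orient 0 (L, D) (-L, 0) +
      orient 0 (-L, 0) (L, -D)) (by fun_prop)
      (by rw [y0, c0, z0, w0]; simp [orient]; nlinarith)))
  obtain ⟨ε, ⟨⟨⟨⟨⟨⟨⟨hε, hε1⟩, hεL⟩, hyI⟩, hzI⟩, hcI⟩, hcx⟩, hRs, hRt⟩,
    ⟨⟨hOyc, hUOz⟩, hcyw⟩, harea⟩ := hev.exists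
  have hzyc : 0 < orient (z ε) (y ε) (c ε) := by
    have : orient (z ε) (y ε) (c ε) = ε * orient (0, 0) (y ε) (c ε) := by
      simp [z, orient]; ring
    rw [this]; positivity
  obtain ⟨E, h, hr, hE1, hE2⟩ := bounds_hexagon hL hD hT hε (by linarith) hyI
  obtain ⟨h, hr⟩ := Bounds.subdivide (a := (0, 0)) (b := y ε) h hr hε1 (by linarith)
  replace h := h.perm (List.rotate_perm _ 1).symm
  replace hr := hr.perm (List.rotate_perm _ 1).symm
  obtain ⟨h, hr⟩ := Bounds.dent (a := z ε) (b := y ε) (c := c ε) h hr hzyc (by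
    intro x hx hx0
    refine ⟨⟨closedTri_subset_openTri hzyc hzI hyI hcI hx, fun hx' => ?_⟩, fun hx' => ?_⟩
    · have h1 := affine_pos_of_mem_closedTri hzyc hx (-1) 0 0
        (by simp [z, y]; exact mul_pos hε1 hε) (by simpa [y]) (by simpa using hcx)
      obtain ⟨-, h2, h3⟩ := hx'
      simp only [orient] at h2 h3
      nlinarith
    · have h1 : orient (z ε) (y ε) x = ε * orient (0, 0) (y ε) x := by
        simp [z, orient]; ring
      rw [h1] at hx0
      have h1 := pos_of_mul_pos_right hx0 hε.le
      have h2 := hx'.2.2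
      rw [orient_swap] at h2
      linarith)
  refine ⟨(L, -D), (0, 0), z ε, c ε, y ε, w ε, (L, D), (-L, 0), _, _,
    h.perm (List.rotate_perm _ 6).symm, ?_, ?_, by linarith, ?_, Or.inr (by linarith), harea⟩
  · exact fun x hx => ⟨⟨⟨F.subset hx, F.wedge x hx⟩, hRs x hx⟩, hRt hzyc x hx⟩
  · rintro x (rfl | rfl | rfl | rfl | rfl)
    · exact Or.inl (hE1 (F.base_mem F.p_pos F.p_lt))
    · exact Or.inl (hE1 (F.base_mem F.q_pos F.q_lt))
    · exact Or.inl (hE2 (F.spike_mem F.r_pos F.r_lt hε))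
    · exact Or.inl (hE2 (F.spike_mem F.s_pos F.s_lt hε))
    · exact Or.inr (mem_baseTri_overshoot hε hzyc)
  · have : orient (z ε) (c ε) (y ε) = -orient (z ε) (y ε) (c ε) := by unfold orient; ring
    linarith

lemma eventually_add_mul_ne_zero {A B : ℝ} (h : A ≠ 0 ∨ B ≠ 0) :
    ∀ᶠ T in Filter.atTop, A + T * B ≠ 0 := by
  by_cases hB : B = 0
  · subst hB
    exact Filter.Eventually.of_forall fun T => by simpa using h
  · filter_upwards [Filter.eventually_gt_atTop (-A / B)] with T hT h0
    refine hT.ne' ?_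
    field_simp
    linarith

lemma mem_symm_openTri_of_lt {L M x y : ℝ} (hM : 0 < M) (hL : 2 * M < L) (hx : |x| < M)
    (hy : |y| < M) : (x, y) ∈ openTri (L, -(4 * M)) (L, 4 * M) (-L, 0) := by
  obtain ⟨hx1, hx2⟩ := abs_lt.1 hx
  obtain ⟨hy1, hy2⟩ := abs_lt.1 hy
  refine mem_symm_openTri (by linarith) (by linarith) ?_ ?_ <;> nlinarith

/-- Two points on each positive half-axis and a further point suitably placed. -/
lemma hasOctagon_of_axes {R : Set (ℝ × ℝ)} (hR : R.Finite) {p q r s α β : ℝ} (hp : 0 < p)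
    (hq : 0 < q) (hr : 0 < r) (hs : 0 < s) (hα : α ≠ 0) (hβ : 0 < α → 0 < β)
    (h1 : ∀ x ∈ R, x.1 ≠ 0) (h2 : ∀ x ∈ R, x.2 ≠ 0) (hb : (α, β) ∉ R) :
    HasOctagon {(p, 0), (q, 0), (0, r), (0, s), (α, β)} R := by
  have hT : ∀ x ∈ R, ∀ᶠ T in Filter.atTop, orient (0, T) (α, β) x ≠ 0 := by
    intro x hx
    have key (T : ℝ) : orient (0, T) (α, β) x = (α * x.2 - β * x.1) + T * (x.1 - α) := by
      simp only [orient]; ring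
    simp only [key]
    refine eventually_add_mul_ne_zero ?_
    by_contra! h
    have hx1 : x.1 = α := by linarith [h.2]
    refine hb ?_
    have : (α, β) = x := by
      ext
      · exact hx1.symm
      · refine mul_left_cancel₀ hα ?_
        have := h.1
        rw [hx1] at this
        simp only
        linarith
    rwa [this]
  obtain ⟨T, ⟨⟨hT0, hTr⟩, hTs⟩, hoff⟩ := ((((Filter.eventually_gt_atTop (0 : ℝ)).and
    (Filter.eventually_gt_atTop (2 * r))).and (Filter.eventually_gt_atTop (2 * s))).and
    (hR.eventually_all.2 hT)).exists
  obtain ⟨M, ⟨⟨⟨⟨hM, hMT⟩, hMα⟩, hMβ⟩, hM1⟩, hM2⟩ := (((((Filter.eventually_gt_atTop (0 : ℝ)).and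
    (Filter.eventually_gt_atTop |T|)).and (Filter.eventually_gt_atTop |α|)).and
    (Filter.eventually_gt_atTop |β|)).and (hR.eventually_all.2
      fun x _ => Filter.eventually_gt_atTop |x.1|)).and (hR.eventually_all.2
      fun x _ => Filter.eventually_gt_atTop |x.2|) |>.exists
  have hlin (a c : ℝ) (hc : 0 < c) : ∀ᶠ L in Filter.atTop, a < L * c :=
    (Filter.tendsto_id.atTop_mul_const hc).eventually_gt_atTop a
  obtain ⟨L, ⟨⟨⟨hLM, hLp⟩, hLq⟩, hw⟩, hLβ⟩ := (((((Filter.eventually_gt_atTop (2 * M)).and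
    (Filter.eventually_gt_atTop p)).and (Filter.eventually_gt_atTop q)).and
    (hR.eventually_all.2 fun x hx => hlin (4 * M * |x.1|) |x.2| (abs_pos.2 (h2 x hx)))).and
    (show ∀ᶠ L in Filter.atTop, 0 < α → 4 * M * α < L * β by
      by_cases h : 0 < α
      · simpa [h] using hlin (4 * M * α) β (hβ h)
      · simp [h])).exists
  have F : Frame R p q r s (α, β) L (4 * M) T :=
    { L_pos := by linarith
      D_pos := by linarith
      T_pos := hT0
      p_pos := hp
      q_pos := hq
      r_pos := hr
      s_pos := hs
      p_lt := hLp
      q_lt := hLq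
      r_lt := hTr
      s_lt := hTs
      finite := hR
      subset := fun x hx => mem_symm_openTri_of_lt hM hLM (hM1 x hx) (hM2 x hx)
      mem := mem_symm_openTri_of_lt hM hLM hMα hMβ
      top_mem := mem_symm_openTri_of_lt hM hLM (by simpa) hMT
      wedge := fun x hx hx' => by
        have h0 := hw x hx
        obtain ⟨-, h3, h4⟩ := hx'
        simp only [orient] at h3 h4
        have h5 := le_abs_self x.1
        have h6 := mul_le_mul_of_nonneg_left h5 hM.le
        rcases abs_cases x.2 with ⟨h7, -⟩ | ⟨h7, -⟩ <;> rw [h7] at h0 <;> nlinarith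
      off_axis := h1
      off_line := hoff }
  rcases hα.lt_or_gt with h | h
  · exact F.hasOctagon_of_neg h
  · exact F.hasOctagon_of_pos h (hLβ h)

lemma SimplePolygon.numConvex_le_of_not_convexAt (P : SimplePolygon) (s : Finset ℕ)
    (hs : s ⊆ Finset.range P.n) (h : ∀ i ∈ s, ¬ P.ConvexAt i) :
    P.numConvex ≤ P.n - s.card := by
  have hsub : {i | i < P.n ∧ P.ConvexAt i} ⊆ ((Finset.range P.n \ s : Finset ℕ) : Set ℕ) := by
    rintro i ⟨hi, hc⟩
    simp only [Finset.coe_sdiff, Set.mem_sdiff, Finset.mem_coe, Finset.mem_range]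
    exact ⟨hi, fun his => h i his hc⟩
  refine (Set.ncard_le_ncard hsub (Finset.finite_toSet _)).trans ?_
  rw [Set.ncard_coe_finset, Finset.card_sdiff_of_subset hs, Finset.card_range]

/-- An octagon with three prescribed reflex vertices is a simple polygon with at most five
convex vertices. -/
lemma Bounds.exists_octagon {a b c d e f g h : Pt} {I E : Set Pt}
    (hB : Bounds [(a, b), (b, c), (c, d), (d, e), (e, f), (f, g), (g, h), (h, a)] I E)
    (habc : det2 (b - a) (c - b) ≤ 0)
    (hrefl : (det2 (c - b) (d - c) ≤ 0 ∧ det2 (d - c) (e - d) ≤ 0) ∨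
      (det2 (c - b) (d - c) ≤ 0 ∧ det2 (e - d) (f - e) ≤ 0) ∨
      (det2 (d - c) (e - d) ≤ 0 ∧ det2 (e - d) (f - e) ≤ 0))
    (harea : 0 < det2 a b + det2 b c + det2 c d + det2 d e + det2 e f + det2 f g + det2 g h +
      det2 h a) :
    ∃ P : SimplePolygon, P.CCW ∧ P.numConvex ≤ 5 ∧ (∀ x ∈ I, x ∈ P.interior) ∧
      ∀ x ∈ E, x ∉ P.region := by
  obtain ⟨P, hn, hv, hI, hE⟩ := Bounds.exists_simplePolygon (l := [a, b, c, d, e, f, g, h])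
    (by simp) hB
  replace hn : P.n = 8 := hn
  have v0 : P.vtx 0 = a := by simp [hv]
  have v1 : P.vtx 1 = b := by simp [hv]
  have v2 : P.vtx 2 = c := by simp [hv]
  have v3 : P.vtx 3 = d := by simp [hv]
  have v4 : P.vtx 4 = e := by simp [hv]
  have v5 : P.vtx 5 = f := by simp [hv]
  have v6 : P.vtx 6 = g := by simp [hv]
  have v7 : P.vtx 7 = h := by simp [hv]
  have v8 : P.vtx 8 = a := by simp [hv]
  refine ⟨P, ?_, ?_, hI, hE⟩
  · unfold SimplePolygon.CCW SimplePolygon.shoelace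
    rw [hn]
    simpa [Finset.sum_range_succ, v0, v1, v2, v3, v4, v5, v6, v7, v8] using harea
  · have key (i j k : ℕ) (hijk : ({i, j, k} : Finset ℕ) ⊆ Finset.range 8)
        (hcard : ({i, j, k} : Finset ℕ).card = 3) (hi : ¬ P.ConvexAt i) (hj : ¬ P.ConvexAt j)
        (hk : ¬ P.ConvexAt k) : P.numConvex ≤ 5 := by
      have := P.numConvex_le_of_not_convexAt {i, j, k} (by rwa [hn]) (by
        simp only [Finset.mem_insert, Finset.mem_singleton]
        rintro _ (rfl | rfl | rfl) <;> assumption)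
      rwa [hcard, hn] at this
    have c0 : P.ConvexAt 0 ↔ 0 < det2 (b - a) (c - b) := by
      simp [SimplePolygon.ConvexAt, v0, v1, v2]
    have c1 : P.ConvexAt 1 ↔ 0 < det2 (c - b) (d - c) := by
      simp [SimplePolygon.ConvexAt, v1, v2, v3]
    have c2 : P.ConvexAt 2 ↔ 0 < det2 (d - c) (e - d) := by
      simp [SimplePolygon.ConvexAt, v2, v3, v4]
    have c3 : P.ConvexAt 3 ↔ 0 < det2 (e - d) (f - e) := by
      simp [SimplePolygon.ConvexAt, v3, v4, v5]
    rw [← not_lt, ← c0] at habc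
    simp only [← not_lt, ← c1, ← c2, ← c3] at hrefl
    rcases hrefl with ⟨h1, h2⟩ | ⟨h1, h2⟩ | ⟨h1, h2⟩
    · exact key 0 1 2 (by decide) (by decide) habc h1 h2
    · exact key 0 1 3 (by decide) (by decide) habc h1 h2
    · exact key 0 2 3 (by decide) (by decide) habc h1 h2

/-- The affine coordinate system with origin `o` and basis `u`, `v`. -/
def affineFrame (o u v : Pt) (z : ℝ × ℝ) : Pt := o + (z.1 • u + z.2 • v)

lemma det2_affineFrame_sub (o u v : Pt) (a b c : ℝ × ℝ) :
    det2 (affineFrame o u v b - affineFrame o u v a) (affineFrame o u v c - affineFrame o u v b) =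
      det2 u v * orient a b c := by
  simp [det2, affineFrame, orient]; ring

lemma exists_homeomorph_affineFrame (o u v : Pt) (h : det2 u v ≠ 0) :
    ∃ f : (ℝ × ℝ) ≃ₜ Pt, (∀ z, f z = affineFrame o u v z) ∧
      ∀ x a b, f x ∈ segment ℝ (f a) (f b) ↔ x ∈ segment ℝ a b := by
  let l : (ℝ × ℝ) ≃ₗ[ℝ] Pt :=
    { toFun := fun z => z.1 • u + z.2 • v
      map_add' := fun x y => by simp only [Prod.fst_add, Prod.snd_add]; module
      map_smul' := fun k x => by
        simp only [Prod.smul_fst, Prod.smul_snd, smul_eq_mul, RingHom.id_apply]; module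
      invFun := fun w => (det2 w v / det2 u v, det2 u w / det2 u v)
      left_inv := fun z => by
        ext
        · simp only
          field_simp
          simp [det2]; ring
        · simp only
          field_simp
          simp [det2]; ring
      right_inv := fun w => by
        ext i
        fin_cases i
        · simp
          field_simp
          simp [det2]; ring
        · simp
          field_simp
          simp [det2]; ring }
  refine ⟨l.toContinuousLinearEquiv.toHomeomorph.trans (Homeomorph.addLeft o), fun z => rfl, ?_⟩
  intro x a b
  change o + l x ∈ segment ℝ (o + l a) (o + l b) ↔ _
  rw [mem_segment_translate, ← LinearEquiv.coe_toLinearMap, ← LinearMap.coe_toAffineMap,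
    ← image_segment]
  exact l.injective.mem_set_image

lemma HasOctagon.exists_polygon {B R : Set (ℝ × ℝ)} (hBR : HasOctagon B R) (o u v : Pt)
    (huv : det2 u v ≠ 0) :
    ∃ P : SimplePolygon, P.CCW ∧ P.numConvex ≤ 5 ∧
      (∀ x ∈ R, affineFrame o u v x ∈ P.interior) ∧ ∀ x ∈ B, affineFrame o u v x ∉ P.region := by
  obtain ⟨a, b, c, d, e, f, g, h, I, E, hB, hRI, hBE, habc, hcde, hor, harea⟩ := hBR
  obtain ⟨F, hF, hseg⟩ := exists_homeomorph_affineFrame o u v huv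
  have hM := hB.map F hseg
  suffices H : ∃ P : SimplePolygon, P.CCW ∧ P.numConvex ≤ 5 ∧ (∀ x ∈ F '' I, x ∈ P.interior) ∧
      ∀ x ∈ F '' E, x ∉ P.region by
    obtain ⟨P, h1, h2, h3, h4⟩ := H
    refine ⟨P, h1, h2, fun x hx => ?_, fun x hx => ?_⟩
    · rw [← hF]; exact h3 _ ⟨x, hRI hx, rfl⟩
    · rw [← hF]; exact h4 _ ⟨x, hBE hx, rfl⟩
  have hdet (x y z : ℝ × ℝ) : det2 (F y - F x) (F z - F y) = det2 u v * orient x y z := by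
    rw [hF, hF, hF, det2_affineFrame_sub]
  have hsum : det2 (F a) (F b) + det2 (F b) (F c) + det2 (F c) (F d) + det2 (F d) (F e) +
      det2 (F e) (F f) + det2 (F f) (F g) + det2 (F g) (F h) + det2 (F h) (F a) =
      det2 u v * (orient 0 a b + orient 0 b c + orient 0 c d + orient 0 d e + orient 0 e f +
      orient 0 f g + orient 0 g h + orient 0 h a) := by
    simp only [hF, det2, affineFrame, orient]
    simp; ring
  rcases huv.lt_or_gt with hneg | hpos
  · have hS := (hM.swap (hM.nodup.perm (List.rotate_perm (List.map F [a, b, c, d, e, f, g, h])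
      1).symm)).perm (List.reverse_perm _).symm
    have hdet' (x y z : ℝ × ℝ) (hxyz : orient x y z ≤ 0) :
        det2 (F y - F z) (F x - F y) ≤ 0 := by
      have h1 := hdet x y z
      have h2 := mul_nonneg_of_nonpos_of_nonpos hneg.le hxyz
      simp only [det2, PiLp.sub_apply] at *
      linarith
    have harea' := mul_neg_of_neg_of_pos hneg harea
    rw [← hsum] at harea'
    rcases hor with hbcd | hdef
    · refine Bounds.exists_octagon (a := F e) (b := F d) (c := F c) (d := F b) (e := F a)
        (f := F h) (g := F g) (h := F f) (hS.perm (List.rotate_perm _ 4).symm)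
        (hdet' _ _ _ hcde) (Or.inl ⟨hdet' _ _ _ hbcd, hdet' _ _ _ habc⟩) ?_
      simp only [det2] at *
      linarith
    · refine Bounds.exists_octagon (a := F f) (b := F e) (c := F d) (d := F c) (e := F b)
        (f := F a) (g := F h) (h := F g) (hS.perm (List.rotate_perm _ 3).symm)
        (hdet' _ _ _ hdef) (Or.inr (Or.inl ⟨hdet' _ _ _ hcde, hdet' _ _ _ habc⟩)) ?_
      simp only [det2] at *
      linarith
  · have hdet' (x y z : ℝ × ℝ) (hxyz : orient x y z ≤ 0) :
        det2 (F y - F x) (F z - F y) ≤ 0 := by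
      rw [hdet]; exact mul_nonpos_of_nonneg_of_nonpos hpos.le hxyz
    refine Bounds.exists_octagon hM (hdet' _ _ _ habc) ?_ (by rw [hsum]; positivity)
    rcases hor with hbcd | hdef
    · exact Or.inl ⟨hdet' _ _ _ hbcd, hdet' _ _ _ hcde⟩
    · exact Or.inr (Or.inr ⟨hdet' _ _ _ hcde, hdet' _ _ _ hdef⟩)

/-- Twice the signed area of the triangle `a b c`. -/
def area (a b c : Pt) : ℝ := det2 (b - a) (c - a)

/-- There is a polygon witnessing the separation of `B` from `R`, with at most five convex
vertices. -/
def SepFive (B R : Set Pt) : Prop :=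
  ∃ P : SimplePolygon, P.CCW ∧ P.numConvex ≤ 5 ∧ (∀ x ∈ R, x ∈ P.interior) ∧
    ∀ x ∈ B, x ∉ P.region

/-- Coordinates of a point with respect to two lines in general position. -/
lemma affineFrame_area (a b c d x : Pt) (h : det2 (b - a) (d - c) ≠ 0) (hA : area c d a ≠ 0)
    (hC : area a b c ≠ 0) :
    affineFrame (a + (area c d a / det2 (b - a) (d - c)) • (b - a))
      (-(area c d a / det2 (b - a) (d - c)) • (b - a))
      ((area a b c / det2 (b - a) (d - c)) • (d - c))
      (area c d x / area c d a, area a b x / area a b c) = x := by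
  ext i
  have key (i : Fin 2) : area c d a * (b i - a i) - area c d x * (b i - a i) +
      area a b x * (d i - c i) = det2 (b - a) (d - c) * (x i - a i) := by
    fin_cases i <;> simp [area, det2] <;> ring
  have := key i
  simp only [affineFrame, PiLp.add_apply, PiLp.smul_apply, PiLp.sub_apply, smul_eq_mul]
  field_simp
  linarith

lemma area_left (a b : Pt) : area a b a = 0 := by simp [area, det2]

lemma area_right (a b : Pt) : area a b b = 0 := by simp [area, det2]; ring

lemma sepFive_of_signs {a b c d e : Pt} {R : Set Pt} (hR : R.Finite)
    (h : det2 (b - a) (d - c) ≠ 0) (hA : 0 < area c d a * area c d b)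
    (hC : 0 < area a b c * area a b d) (h1 : area c d e ≠ 0)
    (hsgn : 0 < area c d e / area c d a → 0 < area a b e / area a b c)
    (hR1 : ∀ x ∈ R, area a b x ≠ 0) (hR2 : ∀ x ∈ R, area c d x ≠ 0) (hR3 : e ∉ R) :
    SepFive {a, b, c, d, e} R := by
  have hA1 : area c d a ≠ 0 := left_ne_zero_of_mul hA.ne'
  have hC1 : area a b c ≠ 0 := left_ne_zero_of_mul hC.ne'
  have hA2 : 0 < area c d b / area c d a := by
    have : area c d b / area c d a = area c d a * area c d b / (area c d a) ^ 2 := by field_simp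
    rw [this]; positivity
  have hC2 : 0 < area a b d / area a b c := by
    have : area a b d / area a b c = area a b c * area a b d / (area a b c) ^ 2 := by field_simp
    rw [this]; positivity
  let φ : Pt → ℝ × ℝ := fun x => (area c d x / area c d a, area a b x / area a b c)
  have hφ (x : Pt) := affineFrame_area a b c d x h hA1 hC1
  set o := a + (area c d a / det2 (b - a) (d - c)) • (b - a)
  have hoct := hasOctagon_of_axes (hR.image φ) one_pos hA2 one_pos hC2
    (α := area c d e / area c d a) (β := area a b e / area a b c) (by positivity) hsgn
    (by rintro _ ⟨x, hx, rfl⟩; exact div_ne_zero (hR2 x hx) hA1)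
    (by rintro _ ⟨x, hx, rfl⟩; exact div_ne_zero (hR1 x hx) hC1)
    (by
      rintro ⟨x, hx, hxe⟩
      refine hR3 ?_
      rw [← hφ e, ← hxe, hφ x]
      exact hx)
  obtain ⟨P, hP1, hP2, hP3, hP4⟩ := hoct.exists_polygon o
    (-(area c d a / det2 (b - a) (d - c)) • (b - a))
    ((area a b c / det2 (b - a) (d - c)) • (d - c)) (by
      have : det2 (-(area c d a / det2 (b - a) (d - c)) • (b - a))
          ((area a b c / det2 (b - a) (d - c)) • (d - c)) =
          -(area c d a / det2 (b - a) (d - c)) * (area a b c / det2 (b - a) (d - c)) *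
            det2 (b - a) (d - c) := by
        generalize area c d a / det2 (b - a) (d - c) = k
        generalize area a b c / det2 (b - a) (d - c) = m
        simp [det2]; ring
      rw [this]
      exact mul_ne_zero (mul_ne_zero (neg_ne_zero.2 (div_ne_zero hA1 h)) (div_ne_zero hC1 h)) h)
  refine ⟨P, hP1, hP2, fun x hx => ?_, ?_⟩
  · rw [← hφ x]
    exact hP3 _ ⟨x, hx, rfl⟩
  · intro x hx
    rw [← hφ x]
    refine hP4 _ ?_
    rcases hx with rfl | rfl | rfl | rfl | rfl
    · simp [area_left, div_self hA1]
    · simp [area_right]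
    · simp [area_left, div_self hC1]
    · simp [area_right]
    · simp

/-- Two pairs of points, each on one side of the line through the other, allow a separation. -/
lemma sepFive_of_pairs {a b c d e : Pt} {R : Set Pt} (hR : R.Finite)
    (h : det2 (b - a) (d - c) ≠ 0) (hA : 0 < area c d a * area c d b)
    (hC : 0 < area a b c * area a b d) (h1 : area c d e ≠ 0) (h2 : area a b e ≠ 0)
    (hR1 : ∀ x ∈ R, area a b x ≠ 0) (hR2 : ∀ x ∈ R, area c d x ≠ 0) (hR3 : e ∉ R) :
    SepFive {a, b, c, d, e} R := by
  by_cases hs : 0 < area c d e / area c d a → 0 < area a b e / area a b c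
  · exact sepFive_of_signs hR h hA hC h1 hs hR1 hR2 hR3
  · push Not at hs
    have := sepFive_of_signs (a := c) (b := d) (c := a) (d := b) (e := e) hR
      (by
        intro h0
        refine h ?_
        simp only [det2] at *
        linarith) hC hA h2 (fun h0 => absurd h0 hs.2.not_gt) hR2 hR1 hR3
    have hset : ({a, b, c, d, e} : Set Pt) = {c, d, a, b, e} := by
      ext x; simp; tauto
    rwa [hset]

/-- Each of the pairs `a, b` and `c, d` lies on one side of the line through the other pair. -/
def SideBySide (a b c d : Pt) : Prop :=
  0 < area c d a * area c d b ∧ 0 < area a b c * area a b d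

lemma mul_pos_of_pos_iff {x y : ℝ} (hx : x ≠ 0) (hy : y ≠ 0) (h : 0 < x ↔ 0 < y) :
    0 < x * y := by
  rcases hx.lt_or_gt with h1 | h1
  · rcases hy.lt_or_gt with h2 | h2
    · exact mul_pos_of_neg_of_neg h1 h2
    · exact absurd (h.2 h2) h1.not_gt
  · exact mul_pos h1 (h.1 h1)

/-- Four points with the orientations of a convex quadrilateral split into two pairs of
opposite sides. -/
lemma sideBySide_of_signs {a b c d : Pt} (h1 : area b c d ≠ 0) (h2 : area a c d ≠ 0)
    (h3 : area a b d ≠ 0) (h4 : area a b c ≠ 0)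
    (h : ((0 < area b c d ↔ 0 < area a c d) ∧ (0 < area a b d ↔ 0 < area a b c)) ∨
      ((0 < area b c d ↔ 0 < area a b c) ∧ (0 < area a c d ↔ 0 < area a b d)) ∨
      ((0 < area b c d ↔ ¬ 0 < area a b d) ∧ (0 < area a c d ↔ ¬ 0 < area a b c))) :
    SideBySide a b c d ∨ SideBySide a c b d ∨ SideBySide a d b c := by
  rcases h with ⟨e1, e2⟩ | ⟨e1, e2⟩ | ⟨e1, e2⟩
  · left
    have k1 := mul_pos_of_pos_iff h1 h2 e1
    have k2 := mul_pos_of_pos_iff h3 h4 e2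
    constructor <;> simp only [area, det2, PiLp.sub_apply] at * <;> linarith
  · right; right
    have k1 := mul_pos_of_pos_iff h1 h4 e1
    have k2 := mul_pos_of_pos_iff h2 h3 e2
    constructor <;> simp only [area, det2, PiLp.sub_apply] at * <;> linarith
  · right; left
    have k1 := mul_pos_of_pos_iff h1 (neg_ne_zero.2 h3)
      (by rw [e1, neg_pos, not_lt]; exact ⟨fun h => h.lt_of_ne h3, le_of_lt⟩)
    have k2 := mul_pos_of_pos_iff h2 (neg_ne_zero.2 h4)
      (by rw [e2, neg_pos, not_lt]; exact ⟨fun h => h.lt_of_ne h4, le_of_lt⟩)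
    constructor <;> simp only [area, det2, PiLp.sub_apply] at * <;> linarith

/-- The four orientations of a quadruple alternate. -/
def alternating (s t u v : Bool) : Bool := (s != t) && (t != u) && (u != v)

/-- The four orientations of a quadruple are those of a convex quadrilateral. -/
def convexSigns (s t u v : Bool) : Bool :=
  ((s == t) && (u == v)) || ((s == v) && (t == u)) || ((s != u) && (t != v))

lemma not_alternating_area {a b c d : Pt} (h1 : area b c d ≠ 0) (h2 : area a c d ≠ 0)
    (h3 : area a b d ≠ 0) (h4 : area a b c ≠ 0) :
    alternating (0 < area b c d) (0 < area a c d) (0 < area a b d) (0 < area a b c) = false := by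
  have key : area b c d + area a b d = area a c d + area a b c := by
    simp only [area, det2, PiLp.sub_apply]; ring
  rcases h1.lt_or_gt with k1 | k1 <;> rcases h2.lt_or_gt with k2 | k2 <;>
    rcases h3.lt_or_gt with k3 | k3 <;> rcases h4.lt_or_gt with k4 | k4 <;>
    first
    | simp [alternating, k1, k2, k3, k4, k1.not_gt, k2.not_gt, k3.not_gt, k4.not_gt]; done
    | linarith

lemma convexSigns_decide (p q r s : Prop) [Decidable p] [Decidable q] [Decidable r] [Decidable s]
    (h : convexSigns p q r s = true) :
    ((p ↔ q) ∧ (r ↔ s)) ∨ ((p ↔ s) ∧ (q ↔ r)) ∨ ((p ↔ ¬ r) ∧ (q ↔ ¬ s)) := by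
  by_cases k1 : p <;> by_cases k2 : q <;> by_cases k3 : r <;> by_cases k4 : s <;>
    simp_all [convexSigns]

lemma sideBySide_of_convexSigns {a b c d : Pt} (h1 : area b c d ≠ 0) (h2 : area a c d ≠ 0)
    (h3 : area a b d ≠ 0) (h4 : area a b c ≠ 0)
    (h : convexSigns (0 < area b c d) (0 < area a c d) (0 < area a b d) (0 < area a b c) = true) :
    SideBySide a b c d ∨ SideBySide a c b d ∨ SideBySide a d b c :=
  sideBySide_of_signs h1 h2 h3 h4 (convexSigns_decide _ _ _ _ h)

/-- Among the orientations of five points some quadruple is convex (Esther Klein). -/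
lemma exists_convexSigns : ∀ s012 s013 s014 s023 s024 s034 s123 s124 s134 s234 : Bool,
    (alternating s123 s023 s013 s012 || alternating s124 s024 s014 s012 ||
      alternating s134 s034 s014 s013 || alternating s234 s034 s024 s023 ||
      alternating s234 s134 s124 s123 ||
      convexSigns s123 s023 s013 s012 || convexSigns s124 s024 s014 s012 ||
      convexSigns s134 s034 s014 s013 || convexSigns s234 s034 s024 s023 ||
      convexSigns s234 s134 s124 s123) = true := by
  decide

lemma separable_of_sideBySide {B R : Finset Pt} (hdisj : Disjoint B R)
    (hgp : StrongGenPos (↑B ∪ ↑R : Set Pt)) {a b c d e : Pt} (hB : B = {a, b, c, d, e})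
    (hnd : [a, b, c, d, e].Nodup) (h : SideBySide a b c d) : Separable B R := by
  have hcard : B.card = 5 := by
    have : B = [a, b, c, d, e].toFinset := by rw [hB]; simp
    rw [this, List.toFinset_card_of_nodup hnd]; rfl
  have hset : (B : Set Pt) = {a, b, c, d, e} := by rw [hB]; simp
  have hmem (x : Pt) (hx : x ∈ [a, b, c, d, e]) : x ∈ (↑B ∪ ↑R : Set Pt) := by
    left; rw [hset]; simpa using hx
  have hne (x : Pt) (hx : x ∈ [a, b, c, d, e]) (y : Pt) (hy : y ∈ R) : x ≠ y := by
    rintro rfl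
    have hxB : x ∈ (B : Set Pt) := by rw [hset]; simpa using hx
    exact Finset.disjoint_left.1 hdisj hxB hy
  simp only [List.nodup_cons, List.mem_cons, List.not_mem_nil, or_false, not_or] at hnd
  obtain ⟨⟨hab, hac, had, hae⟩, ⟨hbc, hbd, hbe⟩, ⟨hcd, hce⟩, hde, -⟩ := hnd
  have ha := hmem a (by simp)
  have hb := hmem b (by simp)
  have hc := hmem c (by simp)
  have hd := hmem d (by simp)
  have he := hmem e (by simp)
  obtain ⟨P, hP1, hP2, hP3, hP4⟩ := sepFive_of_pairs (e := e) R.finite_toSet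
    (hgp.2 a ha b hb c hc d hd hab hac had hbc hbd hcd) h.1 h.2
    (hgp.1 c hc d hd e he hcd hce hde) (hgp.1 a ha b hb e he hab hae hbe)
    (fun x hx => hgp.1 a ha b hb x (Or.inr hx) hab (hne a (by simp) x hx) (hne b (by simp) x hx))
    (fun x hx => hgp.1 c hc d hd x (Or.inr hx) hcd (hne c (by simp) x hx) (hne d (by simp) x hx))
    (fun hx => hne e (by simp) e hx rfl)
  refine ⟨P, hP1, by rwa [hcard], hP3, fun x hx => hP4 x ?_⟩
  rwa [← hset]

lemma separable_of_convexSigns {B R : Finset Pt} (hdisj : Disjoint B R)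
    (hgp : StrongGenPos (↑B ∪ ↑R : Set Pt)) {a b c d e : Pt} (hB : B = {a, b, c, d, e})
    (hnd : [a, b, c, d, e].Nodup) (h1 : area b c d ≠ 0) (h2 : area a c d ≠ 0)
    (h3 : area a b d ≠ 0) (h4 : area a b c ≠ 0)
    (h : convexSigns (0 < area b c d) (0 < area a c d) (0 < area a b d) (0 < area a b c) = true) :
    Separable B R := by
  rcases sideBySide_of_convexSigns h1 h2 h3 h4 h with h | h | h
  · exact separable_of_sideBySide hdisj hgp hB hnd h
  · exact separable_of_sideBySide hdisj hgp (e := e) (by rw [hB]; grind)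
      (by grind) h
  · exact separable_of_sideBySide hdisj hgp (e := e) (by rw [hB]; grind)
      (by grind) h

/-- Any set of exactly five points is separable. -/
theorem five_points_separable
    (B R : Finset Pt) (hdisj : Disjoint B R)
    (hgp : StrongGenPos ((↑B ∪ ↑R : Set Pt)))
    (hcard : B.card = 5) :
    Separable B R := by
  obtain ⟨a, b, c, d, e, hl⟩ : ∃ a b c d e, B.toList = [a, b, c, d, e] := by
    have : B.toList.length = 5 := by simp [hcard]
    match B.toList, this with
    | [a, b, c, d, e], _ => exact ⟨a, b, c, d, e, rfl⟩
  have hnd := B.nodup_toList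
  rw [hl] at hnd
  have hB : B = {a, b, c, d, e} := by
    rw [← B.toList_toFinset, hl]; simp
  have hmem (x : Pt) (hx : x ∈ [a, b, c, d, e]) : x ∈ (↑B ∪ ↑R : Set Pt) := by
    left; rw [hB]; simpa using hx
  have ha := hmem a (by simp)
  have hb := hmem b (by simp)
  have hc := hmem c (by simp)
  have hd := hmem d (by simp)
  have he := hmem e (by simp)
  have hnd' := hnd
  simp only [List.nodup_cons, List.mem_cons, List.not_mem_nil, or_false, not_or] at hnd'
  obtain ⟨⟨hab, hac, had, hae⟩, ⟨hbc, hbd, hbe⟩, ⟨hcd, hce⟩, hde, -⟩ := hnd'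
  have abc : area a b c ≠ 0 := hgp.1 a ha b hb c hc hab hac hbc
  have abd : area a b d ≠ 0 := hgp.1 a ha b hb d hd hab had hbd
  have abe : area a b e ≠ 0 := hgp.1 a ha b hb e he hab hae hbe
  have acd : area a c d ≠ 0 := hgp.1 a ha c hc d hd hac had hcd
  have ace : area a c e ≠ 0 := hgp.1 a ha c hc e he hac hae hce
  have ade : area a d e ≠ 0 := hgp.1 a ha d hd e he had hae hde
  have bcd : area b c d ≠ 0 := hgp.1 b hb c hc d hd hbc hbd hcd
  have bce : area b c e ≠ 0 := hgp.1 b hb c hc e he hbc hbe hce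
  have bde : area b d e ≠ 0 := hgp.1 b hb d hd e he hbd hbe hde
  have cde : area c d e ≠ 0 := hgp.1 c hc d hd e he hcd hce hde
  have key := exists_convexSigns (0 < area a b c) (0 < area a b d) (0 < area a b e)
    (0 < area a c d) (0 < area a c e) (0 < area a d e) (0 < area b c d) (0 < area b c e)
    (0 < area b d e) (0 < area c d e)
  rw [not_alternating_area bcd acd abd abc, not_alternating_area bce ace abe abc,
    not_alternating_area bde ade abe abd, not_alternating_area cde ade ace acd,
    not_alternating_area cde bde bce bcd] at key
  simp only [Bool.false_or, Bool.or_eq_true] at key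
  rcases key with (((h | h) | h) | h) | h
  · exact separable_of_convexSigns hdisj hgp hB hnd bcd acd abd abc h
  · exact separable_of_convexSigns hdisj hgp (e := d) (by rw [hB]; grind)
      (by grind) bce ace abe abc h
  · exact separable_of_convexSigns hdisj hgp (e := c) (by rw [hB]; grind)
      (by grind) bde ade abe abd h
  · exact separable_of_convexSigns hdisj hgp (e := b) (by rw [hB]; grind)
      (by grind) cde ade ace acd h
  · exact separable_of_convexSigns hdisj hgp (e := a) (by rw [hB]; grind)
      (by grind) cde bde bce bcd h
end
end

section
/- Let B be a set of exactly four points in the plane that are in convex position, and let R be a finite set disjoint from B, with B ∪ R in strong general position. Then B is separable from R, i.e., there exists a simple polygon with at most 4 convex vertices whose interior contains all points of R and which contains no point of B. -/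
open scoped RealInnerProductSpace ENNReal Classical

noncomputable section

/-- The point with coordinates `(u, v)` in the affine frame with origin `X` and axes `e`, `f`. -/
def framePt (X e f : Pt) (u v : ℝ) : Pt := X + u • e + v • f

/-- First coordinate of `z` in the affine frame `(X, e, f)`. -/
def frameFst (X e f z : Pt) : ℝ := det2 (z - X) f / det2 e f

/-- Second coordinate of `z` in the affine frame `(X, e, f)`. -/
def frameSnd (X e f z : Pt) : ℝ := det2 e (z - X) / det2 e f

section Frame

variable {X e f : Pt}

theorem frameFst_framePt (h : det2 e f ≠ 0) (u v : ℝ) : frameFst X e f (framePt X e f u v) = u := by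
  rw [frameFst, div_eq_iff h]
  simp only [det2, framePt, PiLp.add_apply, PiLp.sub_apply, PiLp.smul_apply, smul_eq_mul]
  ring

theorem frameSnd_framePt (h : det2 e f ≠ 0) (u v : ℝ) : frameSnd X e f (framePt X e f u v) = v := by
  rw [frameSnd, div_eq_iff h]
  simp only [det2, framePt, PiLp.add_apply, PiLp.sub_apply, PiLp.smul_apply, smul_eq_mul]
  ring

theorem framePt_coords (h : det2 e f ≠ 0) (z : Pt) :
    framePt X e f (frameFst X e f z) (frameSnd X e f z) = z := by
  ext i
  simp only [framePt, frameFst, frameSnd, PiLp.add_apply, PiLp.smul_apply, smul_eq_mul]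
  field_simp
  fin_cases i <;> simp [det2] <;> ring

theorem framePt_inj (h : det2 e f ≠ 0) {a b c d : ℝ} :
    framePt X e f a b = framePt X e f c d ↔ a = c ∧ b = d := by
  refine ⟨fun H => ⟨?_, ?_⟩, fun ⟨h₁, h₂⟩ => by rw [h₁, h₂]⟩
  · simpa only [frameFst_framePt h] using congrArg (frameFst X e f) H
  · simpa only [frameSnd_framePt h] using congrArg (frameSnd X e f) H

theorem det2_framePt_sub (a b c d a' b' c' d' : ℝ) :
    det2 (framePt X e f a b - framePt X e f c d) (framePt X e f a' b' - framePt X e f c' d') =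
      ((a - c) * (b' - d') - (b - d) * (a' - c')) * det2 e f := by
  simp only [det2, framePt, PiLp.add_apply, PiLp.sub_apply, PiLp.smul_apply, smul_eq_mul]
  ring

theorem continuous_framePt : Continuous fun p : ℝ × ℝ => framePt X e f p.1 p.2 := by
  unfold framePt
  fun_prop

theorem continuous_frameFst : Continuous (frameFst X e f) := by
  unfold frameFst det2
  simp only [PiLp.sub_apply]
  fun_prop

theorem continuous_frameSnd : Continuous (frameSnd X e f) := by
  unfold frameSnd det2
  simp only [PiLp.sub_apply]
  fun_prop

theorem framePt_mem_segment_iff (h : det2 e f ≠ 0) {a b c d u v : ℝ} (hac : a < c) :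
    framePt X e f u v ∈ segment ℝ (framePt X e f a b) (framePt X e f c d) ↔
      a ≤ u ∧ u ≤ c ∧ (v - b) * (c - a) = (d - b) * (u - a) := by
  have hca : 0 < c - a := sub_pos.2 hac
  have key : ∀ t : ℝ, framePt X e f a b + t • (framePt X e f c d - framePt X e f a b) =
      framePt X e f (a + t * (c - a)) (b + t * (d - b)) := by
    intro t
    simp only [framePt]
    module
  rw [segment_eq_image']
  simp only [Set.mem_image, key, framePt_inj h, Set.mem_Icc]
  constructor
  · rintro ⟨t, ⟨h0, h1⟩, rfl, rfl⟩
    refine ⟨by nlinarith, by nlinarith, by ring⟩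
  · rintro ⟨h0, h1, h2⟩
    refine ⟨(u - a) / (c - a), ⟨div_nonneg (by linarith) hca.le, ?_⟩, ?_, ?_⟩
    · rw [div_le_one hca]; linarith
    · field_simp; ring
    · field_simp; linarith

theorem isBounded_of_frame_coords (h : det2 e f ≠ 0) {S : Set Pt} {K : ℝ}
    (hS : ∀ z ∈ S, |frameFst X e f z| ≤ K ∧ |frameSnd X e f z| ≤ K) : Bornology.IsBounded S := by
  have hc : IsCompact ((fun p : ℝ × ℝ => framePt X e f p.1 p.2) ''
      (Set.Icc (-K) K ×ˢ Set.Icc (-K) K)) :=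
    (isCompact_Icc.prod isCompact_Icc).image continuous_framePt
  refine hc.isBounded.subset fun z hz => ?_
  obtain ⟨h₁, h₂⟩ := hS z hz
  exact ⟨(frameFst X e f z, frameSnd X e f z), ⟨abs_le.1 h₁, abs_le.1 h₂⟩, framePt_coords h z⟩

end Frame

/-- The vertices of a large triangle from whose corner a thin slit is cut out: the slit follows
the positive first axis of the frame and then turns along the second axis up to height `T`. -/
def slitVertex (X e f : Pt) (m T : ℝ) : ℕ → Pt
  | 0 => framePt X e f (-m) 0
  | 1 => framePt X e f (m - 4) (-(m - 2))
  | 2 => framePt X e f (-1) (-1)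
  | 3 => framePt X e f 0 T
  | 4 => framePt X e f 1 1
  | _ => framePt X e f m m

/-- The edges of the slit triangle, in frame coordinates. -/
def slitEdge (m T u v : ℝ) : ℕ → Prop
  | 0 => -m ≤ u ∧ u ≤ m - 4 ∧ 2 * v = -(u + m)
  | 1 => -1 ≤ u ∧ u ≤ m - 4 ∧ v = -(u + 2)
  | 2 => -1 ≤ u ∧ u ≤ 0 ∧ v = (T + 1) * u + T
  | 3 => 0 ≤ u ∧ u ≤ 1 ∧ v = T - (T - 1) * u
  | 4 => 1 ≤ u ∧ u ≤ m ∧ v = u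
  | _ => -m ≤ u ∧ u ≤ m ∧ 2 * v = u + m

section Slit

variable {X e f : Pt} {m T : ℝ}

theorem mem_slit_segment_iff (h : det2 e f ≠ 0) (hT : 1 < T) (hm : 2 * T + 10 < m) {u v : ℝ}
    {i : ℕ} (hi : i < 6) :
    framePt X e f u v ∈
        segment ℝ (slitVertex X e f m T (i % 6)) (slitVertex X e f m T ((i + 1) % 6)) ↔
      slitEdge m T u v i := by
  interval_cases i <;> simp only [slitVertex, slitEdge, Nat.reduceMod, Nat.reduceAdd]
  · rw [framePt_mem_segment_iff h (by linarith)]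
    refine and_congr_right fun _ => and_congr_right fun _ => ?_
    have : m - 2 ≠ 0 := by linarith
    constructor
    · intro H; apply mul_left_cancel₀ this; linarith
    · intro H; linear_combination (m - 2) * H
  · rw [segment_symm, framePt_mem_segment_iff h (by linarith)]
    refine and_congr_right fun _ => and_congr_right fun _ => ?_
    have : m - 3 ≠ 0 := by linarith
    constructor
    · intro H; apply mul_left_cancel₀ this; linarith
    · intro H; linear_combination (m - 3) * H
  · rw [framePt_mem_segment_iff h (by linarith)]
    refine and_congr_right fun _ => and_congr_right fun _ => ?_
    constructor <;> intro H <;> linarith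
  · rw [framePt_mem_segment_iff h (by linarith)]
    refine and_congr_right fun _ => and_congr_right fun _ => ?_
    constructor <;> intro H <;> linarith
  · rw [framePt_mem_segment_iff h (by linarith)]
    refine and_congr_right fun _ => and_congr_right fun _ => ?_
    have : m - 1 ≠ 0 := by linarith
    constructor
    · intro H; apply mul_left_cancel₀ this; linarith
    · intro H; linear_combination (m - 1) * H
  · rw [segment_symm, framePt_mem_segment_iff h (by linarith)]
    refine and_congr_right fun _ => and_congr_right fun _ => ?_
    have : m ≠ 0 := by linarith
    constructor
    · intro H; apply mul_left_cancel₀ this; linarith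
    · intro H; linear_combination m * H

theorem slitEdge_inter (h : det2 e f ≠ 0) (hT : 1 < T) (hm : 2 * T + 10 < m) {u v : ℝ}
    {i j : ℕ} (hij : i < j) (hj : j < 6) (h₁ : slitEdge m T u v i) (h₂ : slitEdge m T u v j) :
    (j = i + 1 ∧ framePt X e f u v = slitVertex X e f m T j) ∨
      (i = 0 ∧ j = 5 ∧ framePt X e f u v = slitVertex X e f m T 0) := by
  interval_cases j <;> interval_cases i <;>
    simp only [slitEdge, slitVertex, framePt_inj h] at h₁ h₂ ⊢ <;>
    obtain ⟨a₁, a₂, a₃⟩ := h₁ <;> obtain ⟨b₁, b₂, b₃⟩ := h₂ <;>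
    norm_num
  · constructor <;> linarith
  · nlinarith
  · have : u = -1 := by nlinarith
    constructor <;> linarith
  · nlinarith
  · nlinarith
  · constructor <;> nlinarith
  · linarith
  · linarith
  · linarith
  · have : u = 1 := by linarith
    constructor <;> linarith
  · constructor <;> linarith
  · linarith
  · nlinarith
  · nlinarith
  · constructor <;> linarith

/-- The slit triangle, as a simple polygon. -/
def slitPolygon (X e f : Pt) (m T : ℝ) (h : det2 e f ≠ 0) (hT : 1 < T) (hm : 2 * T + 10 < m) :
    SimplePolygon where
  n := 6
  three_le := by norm_num
  vtx i := slitVertex X e f m T (i % 6)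
  periodic i := by simp
  inj i hi j hj hij := by
    interval_cases i <;> interval_cases j <;>
      simp only [slitVertex, framePt_inj h, Nat.reduceMod] at hij <;> first | rfl | skip
    all_goals (exfalso; obtain ⟨h₁, h₂⟩ := hij; linarith)
  simple x := by
    rw [← framePt_coords (X := X) h x]
    by_contra! hlt
    rw [Set.two_lt_ncard_iff ((Set.finite_lt_nat 6).subset fun i hi => hi.1)] at hlt
    obtain ⟨a, b, c, ⟨ha, ha'⟩, ⟨hb, hb'⟩, ⟨hc, hc'⟩, hab, hac, hbc⟩ := hlt
    rw [mem_slit_segment_iff h hT hm ha] at ha'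
    rw [mem_slit_segment_iff h hT hm hb] at hb'
    rw [mem_slit_segment_iff h hT hm hc] at hc'
    have key : ∀ i j, i < j → j < 6 → slitEdge m T (frameFst X e f x) (frameSnd X e f x) i →
        slitEdge m T (frameFst X e f x) (frameSnd X e f x) j → j = i + 1 ∨ (i = 0 ∧ j = 5) :=
      fun i j hij hj hi' hj' =>
        (slitEdge_inter (X := X) h hT hm hij hj hi' hj').imp And.left fun H => ⟨H.1, H.2.1⟩
    have h₁ := fun hl => key a b hl hb ha' hb'
    have h₂ := fun hl => key b a hl ha hb' ha'
    have h₃ := fun hl => key a c hl hc ha' hc'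
    have h₄ := fun hl => key c a hl ha hc' ha'
    have h₅ := fun hl => key b c hl hc hb' hc'
    have h₆ := fun hl => key c b hl hb hc' hb'
    omega
  vtx_of_two x hx := by
    rw [← framePt_coords (X := X) h x] at hx ⊢
    obtain ⟨i, j, hne, hs⟩ := Set.ncard_eq_two.1 hx
    have hi : i ∈ ({i, j} : Set ℕ) := by simp
    have hj : j ∈ ({i, j} : Set ℕ) := by simp
    rw [← hs] at hi hj
    obtain ⟨hi, hi'⟩ := hi
    obtain ⟨hj, hj'⟩ := hj
    rw [mem_slit_segment_iff h hT hm hi] at hi'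
    rw [mem_slit_segment_iff h hT hm hj] at hj'
    wlog hij : i < j generalizing i j
    · exact this j i hne.symm (by rw [hs, Set.pair_comm]) hj hj' hi hi' (by omega)
    rcases slitEdge_inter (X := X) h hT hm hij hj hi' hj' with ⟨-, H⟩ | ⟨-, -, H⟩
    · exact ⟨j, hj, by rw [Nat.mod_eq_of_lt hj]; exact H⟩
    · exact ⟨0, by norm_num, H⟩

variable {h : det2 e f ≠ 0} {hT : 1 < T} {hm : 2 * T + 10 < m}

theorem slitPolygon_ccw (h0 : 0 < det2 e f) : (slitPolygon X e f m T h hT hm).CCW := by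
  have : (slitPolygon X e f m T h hT hm).shoelace = (2 * m ^ 2 - 4 * m + 6 - 2 * T) * det2 e f := by
    simp only [SimplePolygon.shoelace, slitPolygon, Finset.sum_range_succ, Finset.sum_range_zero,
      slitVertex, Nat.reduceMod, Nat.reduceAdd]
    simp only [det2, framePt, PiLp.add_apply, PiLp.smul_apply, smul_eq_mul]
    ring
  rw [SimplePolygon.CCW, this]
  exact mul_pos (by nlinarith) h0

theorem slitPolygon_numConvex_le (h0 : 0 < det2 e f) :
    (slitPolygon X e f m T h hT hm).numConvex ≤ 4 := by
  have hsub : {i | i < (slitPolygon X e f m T h hT hm).n ∧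
      (slitPolygon X e f m T h hT hm).ConvexAt i} ⊆ (({0, 3, 4, 5} : Finset ℕ) : Set ℕ) := by
    rintro i ⟨hi, hc⟩
    change i < 6 at hi
    have key : i ≠ 1 ∧ i ≠ 2 := by
      constructor <;> rintro rfl <;>
        simp only [SimplePolygon.ConvexAt, slitPolygon, slitVertex, Nat.reduceMod, Nat.reduceAdd,
          det2_framePt_sub] at hc <;>
        refine absurd (pos_of_mul_pos_left hc h0.le) (not_lt.2 ?_) <;> nlinarith
    simp only [Finset.coe_insert, Finset.coe_singleton, Set.mem_insert_iff, Set.mem_singleton_iff]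
    omega
  have := Set.ncard_le_ncard hsub (Finset.finite_toSet _)
  rw [Set.ncard_coe_finset] at this
  exact this

theorem mem_slitPolygon_boundary_iff {z : Pt} :
    z ∈ (slitPolygon X e f m T h hT hm).boundary ↔
      ∃ i < 6, slitEdge m T (frameFst X e f z) (frameSnd X e f z) i := by
  simp only [SimplePolygon.boundary, Set.mem_iUnion, Finset.mem_range, exists_prop]
  refine exists_congr fun i => and_congr_right fun hi => ?_
  change z ∈ segment ℝ (slitVertex X e f m T (i % 6)) (slitVertex X e f m T ((i + 1) % 6)) ↔ _
  rw [← mem_slit_segment_iff (X := X) h hT hm hi, framePt_coords h]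

/-- The open region enclosed by the slit triangle, in frame coordinates. -/
def slitInside (m T u v : ℝ) : Prop :=
  -(u + m) < 2 * v ∧ 2 * v < u + m ∧
    (v < -(u + 2) ∨ (T + 1) * u + T < v ∨ (u < v ∧ T - (T - 1) * u < v))

/-- The open region outside the slit triangle, in frame coordinates. -/
def slitOutside (m T u v : ℝ) : Prop :=
  2 * v < -(u + m) ∨ u + m < 2 * v ∨
    (-(u + 2) < v ∧ v < (T + 1) * u + T ∧ (v < u ∨ v < T - (T - 1) * u))

theorem not_slitInside_and_slitOutside {u v : ℝ} :
    ¬ (slitInside m T u v ∧ slitOutside m T u v) := by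
  rintro ⟨⟨h₁, h₂, h₃⟩, h₄ | h₄ | ⟨h₄, h₅, h₆⟩⟩
  · linarith
  · linarith
  · rcases h₃ with h₃ | h₃ | ⟨h₃, h₇⟩
    · linarith
    · linarith
    · rcases h₆ with h₆ | h₆ <;> linarith

theorem slitEdge_of_not_inside_outside (hT : 1 < T) (hm : 2 * T + 10 < m) {u v : ℝ}
    (hi : ¬ slitInside m T u v) (ho : ¬ slitOutside m T u v) :
    ∃ i < 6, slitEdge m T u v i := by
  unfold slitInside at hi
  unfold slitOutside at ho
  push Not at hi ho
  obtain ⟨o₁, o₂, o₃⟩ := ho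
  rcases o₁.eq_or_lt with e₁ | l₁
  · refine ⟨0, by norm_num, by linarith, ?_, e₁.symm⟩
    by_contra! hu
    have := (o₃ (by linarith) (by nlinarith)).1
    linarith
  rcases o₂.eq_or_lt with e₂ | l₂
  · refine ⟨5, by norm_num, by linarith, ?_, e₂⟩
    by_contra! hu
    have := (o₃ (by linarith) (by nlinarith)).1
    linarith
  obtain ⟨i₁, i₂, i₃⟩ := hi l₁ l₂
  rcases i₁.eq_or_lt with e₁ | l₃
  · exact ⟨1, by norm_num, by nlinarith, by linarith, e₁.symm⟩
  rcases i₂.eq_or_lt with e₂ | l₄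
  · refine ⟨2, by norm_num, by nlinarith, ?_, e₂⟩
    by_contra! hu
    have := i₃ (by nlinarith)
    nlinarith
  obtain ⟨o₄, o₅⟩ := o₃ l₃ l₄
  rcases o₄.eq_or_lt with e₄ | l₅
  · exact ⟨4, by norm_num, by nlinarith, by linarith, e₄.symm⟩
  · have e₅ := (i₃ l₅).antisymm o₅
    exact ⟨3, by norm_num, by nlinarith, by nlinarith, e₅⟩

theorem mem_slitPolygon_interior {u v : ℝ} (huv : slitInside m T u v) :
    framePt X e f u v ∈ (slitPolygon X e f m T h hT hm).interior := by
  set P := slitPolygon X e f m T h hT hm with hP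
  set z := framePt X e f u v
  have hu := continuous_frameFst (X := X) (e := e) (f := f)
  have hv := continuous_frameSnd (X := X) (e := e) (f := f)
  set U : Set Pt := {z | slitInside m T (frameFst X e f z) (frameSnd X e f z)}
  set V : Set Pt := {z | slitOutside m T (frameFst X e f z) (frameSnd X e f z)}
  have hUo : IsOpen U := by
    simp only [U, slitInside, Set.ofPred_and, Set.ofPred_or]
    refine (isOpen_lt ?_ ?_).inter ((isOpen_lt ?_ ?_).inter ((isOpen_lt ?_ ?_).union
      ((isOpen_lt ?_ ?_).union ((isOpen_lt ?_ ?_).inter (isOpen_lt ?_ ?_))))) <;> fun_prop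
  have hVo : IsOpen V := by
    simp only [V, slitOutside, Set.ofPred_and, Set.ofPred_or]
    refine (isOpen_lt ?_ ?_).union ((isOpen_lt ?_ ?_).union ((isOpen_lt ?_ ?_).inter
      ((isOpen_lt ?_ ?_).inter ((isOpen_lt ?_ ?_).union (isOpen_lt ?_ ?_))))) <;> fun_prop
  have hzU : z ∈ U := by
    change slitInside _ _ _ _
    rwa [frameFst_framePt h, frameSnd_framePt h]
  have hzb : z ∉ P.boundary := by
    rw [hP, mem_slitPolygon_boundary_iff, frameFst_framePt h, frameSnd_framePt h]
    rintro ⟨i, hi, hE⟩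
    obtain ⟨h₁, h₂, h₃⟩ := huv
    interval_cases i <;> obtain ⟨a₁, a₂, a₃⟩ := hE
    · linarith
    · rcases h₃ with h₃ | h₃ | h₃ <;> nlinarith
    · rcases h₃ with h₃ | h₃ | h₃ <;> nlinarith
    · rcases h₃ with h₃ | h₃ | h₃ <;> nlinarith
    · rcases h₃ with h₃ | h₃ | h₃ <;> nlinarith
    · linarith
  refine ⟨hzb, ?_⟩
  have hsub : connectedComponentIn P.boundaryᶜ z ⊆ U := by
    refine isPreconnected_connectedComponentIn.subset_left_of_subset_union hUo hVo ?_ ?_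
      ⟨z, mem_connectedComponentIn hzb, hzU⟩
    · exact Set.disjoint_left.2 fun w hw hw' => not_slitInside_and_slitOutside ⟨hw, hw'⟩
    · refine (connectedComponentIn_subset _ _).trans fun w hw => ?_
      by_contra hcon
      rw [Set.mem_union, not_or] at hcon
      exact hw (mem_slitPolygon_boundary_iff.2 (slitEdge_of_not_inside_outside hT hm hcon.1 hcon.2))
  refine Bornology.IsBounded.subset ?_ hsub
  refine isBounded_of_frame_coords (X := X) (K := m) h ?_
  rintro w ⟨h₁, h₂, h₃⟩
  have h₄ : frameFst X e f w ≤ m := by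
    rcases h₃ with h₃ | h₃ | h₃ <;> nlinarith
  refine ⟨abs_le.2 ⟨by linarith, h₄⟩, abs_le.2 ⟨by linarith, by linarith⟩⟩

theorem not_mem_slitPolygon_region {b : Pt}
    (hb : ∃ c > 0, b = framePt X e f c 0 ∨ (c < T ∧ b = framePt X e f 0 c)) :
    b ∉ (slitPolygon X e f m T h hT hm).region := by
  set P := slitPolygon X e f m T h hT hm with hP
  have hE : ∀ u v, (v = 0 ∧ 0 ≤ u) ∨ (u = 0 ∧ 0 ≤ v ∧ v < T) →
      framePt X e f u v ∈ P.boundaryᶜ := by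
    intro u v huv
    rw [Set.mem_compl_iff, hP, mem_slitPolygon_boundary_iff, frameFst_framePt h,
      frameSnd_framePt h]
    rintro ⟨i, hi, hE⟩
    rcases huv with ⟨rfl, hu⟩ | ⟨rfl, hv, hv'⟩ <;>
      interval_cases i <;> obtain ⟨a₁, a₂, a₃⟩ := hE <;> nlinarith
  set A : Set Pt := (fun u => framePt X e f u 0) '' Set.Ici 0
  set C : Set Pt := (fun v => framePt X e f 0 v) '' Set.Ico 0 T
  have hA : IsPreconnected A := isPreconnected_Ici.image _
    (continuous_framePt.comp (by fun_prop : Continuous fun u : ℝ => (u, (0 : ℝ)))).continuousOn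
  have hC : IsPreconnected C := isPreconnected_Ico.image _
    (continuous_framePt.comp (by fun_prop : Continuous fun v : ℝ => ((0 : ℝ), v))).continuousOn
  have hAC : IsPreconnected (A ∪ C) :=
    IsPreconnected.union (framePt X e f 0 0) ⟨0, Set.self_mem_Ici, rfl⟩
      ⟨0, ⟨le_rfl, by linarith⟩, rfl⟩ hA hC
  have hsub : A ∪ C ⊆ P.boundaryᶜ := by
    rintro _ (⟨u, hu, rfl⟩ | ⟨v, hv, rfl⟩)
    · exact hE _ _ (Or.inl ⟨rfl, hu⟩)
    · exact hE _ _ (Or.inr ⟨rfl, hv.1, hv.2⟩)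
  have hbAC : b ∈ A ∪ C := by
    obtain ⟨c, hc, rfl | ⟨hcT, rfl⟩⟩ := hb
    · exact Or.inl ⟨c, le_of_lt hc, rfl⟩
    · exact Or.inr ⟨c, ⟨le_of_lt hc, hcT⟩, rfl⟩
  rintro (hbd | ⟨-, hbd⟩)
  · exact hsub hbAC hbd
  · have hAb : Bornology.IsBounded (frameFst X e f '' closure A) :=
      (((hbd.subset (hAC.subset_connectedComponentIn hbAC hsub)).subset
        Set.subset_union_left).isCompact_closure.image continuous_frameFst).isBounded
    refine not_bddAbove_Ici (a := (0 : ℝ)) (hAb.bddAbove.mono ?_)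
    intro u hu
    exact ⟨framePt X e f u 0, subset_closure ⟨u, hu, rfl⟩, frameFst_framePt h u 0⟩

end Slit

theorem separable_of_slit {X e f : Pt} {m T : ℝ} (h0 : 0 < det2 e f) (hT : 1 < T)
    (hm : 2 * T + 10 < m) {B R : Finset Pt} (hB : B.card = 4)
    (hBc : ∀ b ∈ B, ∃ c > 0, b = framePt X e f c 0 ∨ (c < T ∧ b = framePt X e f 0 c))
    (hR : ∀ z ∈ R, ∃ u v, z = framePt X e f u v ∧ 1 < |u| ∧ |u| + 2 < |v| ∧ |u| + 2 * |v| < m) :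
    Separable B R := by
  refine ⟨slitPolygon X e f m T h0.ne' hT hm, slitPolygon_ccw h0,
    hB ▸ slitPolygon_numConvex_le h0, fun z hz => ?_,
    fun b hb => not_mem_slitPolygon_region (hBc b hb)⟩
  obtain ⟨u, v, rfl, h₁, h₂, h₃⟩ := hR z hz
  apply mem_slitPolygon_interior
  rcases abs_cases u with ⟨hu, hu'⟩ | ⟨hu, hu'⟩ <;>
    rcases abs_cases v with ⟨hv, hv'⟩ | ⟨hv, hv'⟩ <;>
    rw [hu] at h₁ h₂ h₃ <;> rw [hv] at h₂ h₃ <;>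
    refine ⟨by linarith, by linarith, ?_⟩
  · exact Or.inr (Or.inr ⟨by linarith, by nlinarith⟩)
  · exact Or.inl (by linarith)
  · exact Or.inr (Or.inl (by nlinarith))
  · exact Or.inl (by linarith)

theorem separable_of_axes {X e f : Pt} (h0 : 0 < det2 e f) {B R : Finset Pt} (hB : B.card = 4)
    (hBc : ∀ b ∈ B, ∃ c > (0 : ℝ), b = framePt X e f c 0 ∨ b = framePt X e f 0 c)
    (hR : ∀ z ∈ R, frameFst X e f z ≠ 0 ∧ frameSnd X e f z ≠ 0) :
    Separable B R := by
  obtain ⟨k, hk, hkR⟩ : ∃ k > (0 : ℝ), ∀ z ∈ R, k < |frameFst X e f z| := by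
    have : ∀ᶠ k in nhdsWithin (0 : ℝ) (Set.Ioi 0), ∀ z ∈ R, k < |frameFst X e f z| :=
      (R.eventually_all).2 fun z hz =>
        nhdsWithin_le_nhds (eventually_lt_nhds (abs_pos.2 (hR z hz).1))
    exact ((eventually_mem_nhdsWithin.and this).exists).imp fun k hk => ⟨hk.1, hk.2⟩
  obtain ⟨s, hs, hsR⟩ : ∃ s > (0 : ℝ), ∀ z ∈ R,
      s * (|frameFst X e f z / k| + 2) < |frameSnd X e f z| := by
    have : ∀ᶠ s in nhdsWithin (0 : ℝ) (Set.Ioi 0), ∀ z ∈ R,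
        s * (|frameFst X e f z / k| + 2) < |frameSnd X e f z| := by
      refine (R.eventually_all).2 fun z hz => nhdsWithin_le_nhds ?_
      have hc : Continuous fun s : ℝ => s * (|frameFst X e f z / k| + 2) := by fun_prop
      refine hc.continuousAt.eventually_lt continuousAt_const ?_
      simpa using (hR z hz).2
    exact ((eventually_mem_nhdsWithin.and this).exists).imp fun k hk => ⟨hk.1, hk.2⟩
  obtain ⟨T, hT, hTB⟩ : ∃ T > (1 : ℝ), ∀ b ∈ B, frameSnd X e f b / s < T := by
    have : ∀ᶠ T in Filter.atTop, ∀ b ∈ B, frameSnd X e f b / s < T :=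
      (B.eventually_all).2 fun b _ => Filter.eventually_gt_atTop _
    exact (((Filter.eventually_gt_atTop (1 : ℝ)).and this).exists).imp fun k hk => ⟨hk.1, hk.2⟩
  obtain ⟨m, hm, hmR⟩ : ∃ m > 2 * T + 10, ∀ z ∈ R,
      |frameFst X e f z / k| + 2 * |frameSnd X e f z / s| < m := by
    have : ∀ᶠ m in Filter.atTop, ∀ z ∈ R,
        |frameFst X e f z / k| + 2 * |frameSnd X e f z / s| < m :=
      (R.eventually_all).2 fun b _ => Filter.eventually_gt_atTop _
    exact (((Filter.eventually_gt_atTop (2 * T + 10)).and this).exists).imp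
      fun k hk => ⟨hk.1, hk.2⟩
  have hscale : ∀ u v, framePt X e f u v = framePt X (k • e) (s • f) (u / k) (v / s) := by
    intro u v
    simp only [framePt, smul_smul, div_mul_cancel₀ _ hk.ne', div_mul_cancel₀ _ hs.ne']
  have h1 : det2 (k • e) (s • f) = k * s * det2 e f := by
    simp only [det2, PiLp.smul_apply, smul_eq_mul]
    ring
  refine separable_of_slit (X := X) (e := k • e) (f := s • f) (h1 ▸ by positivity) hT hm hB
    (fun b hb => ?_) fun z hz => ?_
  · obtain ⟨c, hc, hbc | hbc⟩ := hBc b hb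
    · refine ⟨c / k, div_pos hc hk, Or.inl ?_⟩
      rw [hbc, hscale, zero_div]
    · refine ⟨c / s, div_pos hc hs, Or.inr ⟨?_, ?_⟩⟩
      · have := hTB b hb
        rwa [hbc, frameSnd_framePt h0.ne'] at this
      · rw [hbc, hscale, zero_div]
  · refine ⟨frameFst X e f z / k, frameSnd X e f z / s, ?_, ?_, ?_, hmR z hz⟩
    · rw [← hscale, framePt_coords h0.ne']
    · rw [abs_div, abs_of_pos hk, one_lt_div hk]
      exact hkR z hz
    · rw [abs_div (frameSnd X e f z), abs_of_pos hs, lt_div_iff₀ hs, mul_comm]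
      exact hsR z hz

theorem separable_of_axes_of_ne {X e f : Pt} (h0 : det2 e f ≠ 0) {B R : Finset Pt}
    (hB : B.card = 4)
    (hBc : ∀ b ∈ B, ∃ c > (0 : ℝ), b = X + c • e ∨ b = X + c • f)
    (hR : ∀ z ∈ R, det2 (z - X) f ≠ 0 ∧ det2 e (z - X) ≠ 0) :
    Separable B R := by
  have hswap : ∀ u v : Pt, det2 u v = -det2 v u := fun u v => by simp only [det2]; ring
  wlog hpos : 0 < det2 e f generalizing e f
  · have hfe : 0 < det2 f e := by
      rw [hswap]
      exact neg_pos.2 (lt_of_le_of_ne (not_lt.1 hpos) h0)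
    refine this hfe.ne' (fun b hb => ?_) (fun z hz => ?_) hfe
    · obtain ⟨c, hc, h⟩ := hBc b hb
      exact ⟨c, hc, h.symm⟩
    · rw [hswap, neg_ne_zero, hswap f, neg_ne_zero]
      exact (hR z hz).symm
  · refine separable_of_axes hpos hB (X := X) ?_ fun z hz =>
      ⟨div_ne_zero (hR z hz).1 h0, div_ne_zero (hR z hz).2 h0⟩
    simpa [framePt] using hBc

theorem separable_of_crossing {p q r t : Pt} {B R : Finset Pt} {α β γ δ : ℝ}
    (hB : B = {p, q, r, t}) (hcard : B.card = 4) (hdisj : Disjoint B R)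
    (hgp : StrongGenPos ((↑B ∪ ↑R : Set Pt)))
    (hpq : p ≠ q) (hpr : p ≠ r) (hpt : p ≠ t) (hqr : q ≠ r) (hqt : q ≠ t) (hrt : r ≠ t)
    (hα : 0 < α) (hβ : 0 < β) (hγ : γ < 0) (hδ : δ < 0) (hsum : α + β + γ + δ = 0)
    (hrel : α • p + β • q + γ • r + δ • t = 0) :
    Separable B R := by
  have hp : p ∈ B := by simp [hB]
  have hq : q ∈ B := by simp [hB]
  have hr : r ∈ B := by simp [hB]
  have ht : t ∈ B := by simp [hB]
  have hpar : det2 (r - p) (t - q) ≠ 0 :=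
    hgp.2 p (Or.inl hp) r (Or.inl hr) q (Or.inl hq) t (Or.inl ht) hpr hpq hpt hqr.symm hrt hqt
  have hc : ∀ i, α * p i + β * q i + γ * r i + δ * t i = 0 := fun i => by
    simpa using congrArg (fun z : Pt => z i) hrel
  have hσ : α + γ ≠ 0 := by
    intro h
    obtain rfl : γ = -α := by linarith
    obtain rfl : δ = -β := by linarith
    refine hpar (mul_left_cancel₀ hβ.ne' ?_)
    simp only [det2, PiLp.sub_apply]
    linear_combination (-(r 0 - p 0)) * hc 1 + (r 1 - p 1) * hc 0
  set σ := α + γ with hσdef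
  have hαe : α = σ - γ := by linarith
  have hβe : β = -σ - δ := by linarith
  obtain ⟨e, he⟩ : ∃ e, e = σ⁻¹ • (r - p) := ⟨_, rfl⟩
  obtain ⟨f, hf⟩ : ∃ f, f = σ⁻¹ • (q - t) := ⟨_, rfl⟩
  obtain ⟨X, hX⟩ : ∃ X, X = p + γ • e := ⟨_, rfl⟩
  have hre : r = X + α • e := by
    have : σ • e = r - p := by rw [he, smul_inv_smul₀ hσ]
    rw [hX, hαe, sub_smul, this]
    abel
  have hqf : q = X - δ • f := by
    rw [hX, he, hf]
    ext i
    simp only [PiLp.add_apply, PiLp.sub_apply, PiLp.smul_apply, smul_eq_mul]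
    field_simp
    have := hc i
    rw [hαe, hβe] at this
    linarith
  have htf : t = X + β • f := by
    have : σ • f = q - t := by rw [hf, smul_inv_smul₀ hσ]
    have h2 : X = q + δ • f := by rw [hqf]; abel
    rw [h2, hβe, sub_smul, neg_smul, this]
    abel
  have hdet : ∀ (a b : ℝ) (u v : Pt), det2 (a • u) (b • v) = a * b * det2 u v := fun a b u v => by
    simp only [det2, PiLp.smul_apply, smul_eq_mul]
    ring
  refine separable_of_axes_of_ne (X := X) (e := e) (f := f) ?_ hcard ?_ ?_
  · rw [he, hf, hdet]
    refine mul_ne_zero (mul_ne_zero (inv_ne_zero hσ) (inv_ne_zero hσ)) ?_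
    contrapose! hpar
    simp only [det2, PiLp.sub_apply] at hpar ⊢
    linarith
  · intro b hb
    rw [hB] at hb
    simp only [Finset.mem_insert, Finset.mem_singleton] at hb
    rcases hb with rfl | rfl | rfl | rfl
    · exact ⟨-γ, by linarith, Or.inl (by rw [hX]; module)⟩
    · exact ⟨-δ, by linarith, Or.inr (by rw [neg_smul, ← sub_eq_add_neg]; exact hqf)⟩
    · exact ⟨α, hα, Or.inl hre⟩
    · exact ⟨β, hβ, Or.inr htf⟩
  · intro z hz
    have hzB : ∀ b ∈ B, b ≠ z := fun b hb => by
      rintro rfl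
      exact Finset.disjoint_left.1 hdisj hb hz
    constructor
    · have h1 := hgp.1 q (Or.inl hq) t (Or.inl ht) z (Or.inr hz) hqt (hzB q hq) (hzB t ht)
      have h2 : X = q + δ • f := by rw [hqf]; abel
      contrapose! h1
      rw [h2] at h1
      refine mul_left_cancel₀ (inv_ne_zero hσ) ?_
      simp only [hf, det2, PiLp.sub_apply, PiLp.add_apply, PiLp.smul_apply, smul_eq_mul] at h1 ⊢
      linear_combination h1
    · have h1 := hgp.1 p (Or.inl hp) r (Or.inl hr) z (Or.inr hz) hpr (hzB p hp) (hzB r hr)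
      contrapose! h1
      rw [hX] at h1
      refine mul_left_cancel₀ (inv_ne_zero hσ) ?_
      simp only [he, det2, PiLp.sub_apply, PiLp.add_apply, PiLp.smul_apply, smul_eq_mul] at h1 ⊢
      linear_combination h1

theorem mem_convexHull_of_smul_eq {p q r t : Pt} {a x y z : ℝ} (ha : 0 < a) (hx : 0 ≤ x)
    (hy : 0 ≤ y) (hz : 0 ≤ z) (hsum : x + y + z = a) (hrel : a • p = x • q + y • r + z • t)
    {S : Set Pt} (hq : q ∈ S) (hr : r ∈ S) (ht : t ∈ S) : p ∈ convexHull ℝ S := by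
  have hp : p = (x / a) • q + (y / a) • r + (z / a) • t := by
    rw [← inv_smul_smul₀ ha.ne' p, hrel]
    simp only [smul_add, smul_smul, div_eq_inv_mul]
  rw [hp]
  refine (convex_convexHull ℝ S).sum_mem (t := Finset.univ) (w := ![x / a, y / a, z / a])
    (z := ![q, r, t]) ?_ ?_ ?_ |> fun h => by simpa [Fin.sum_univ_three] using h
  · intro i _
    fin_cases i <;> simp <;> positivity
  · simp [Fin.sum_univ_three]
    field_simp
    exact hsum
  · intro i _
    fin_cases i
    · exact subset_convexHull ℝ S hq
    · exact subset_convexHull ℝ S hr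
    · exact subset_convexHull ℝ S ht

theorem separable_of_affine_relation {p q r t : Pt} {B R : Finset Pt} {α β γ δ : ℝ}
    (hB : B = {p, q, r, t}) (hcard : B.card = 4) (hdisj : Disjoint B R)
    (hgp : StrongGenPos ((↑B ∪ ↑R : Set Pt)))
    (hconv : ∀ b ∈ B, b ∉ convexHull ℝ (↑(B.erase b) : Set Pt))
    (hpq : p ≠ q) (hpr : p ≠ r) (hpt : p ≠ t) (hqr : q ≠ r) (hqt : q ≠ t) (hrt : r ≠ t)
    (hα : 0 < α) (hβ : β ≠ 0) (hγ : γ ≠ 0) (hδ : δ ≠ 0) (hsum : α + β + γ + δ = 0)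
    (hrel : α • p + β • q + γ • r + δ • t = 0) :
    Separable B R := by
  have hhull : ∀ {a b c d : Pt} {w x y z : ℝ}, B = {a, b, c, d} → a ≠ b → a ≠ c → a ≠ d →
      0 < w → x < 0 → y < 0 → z < 0 → w + x + y + z = 0 →
      w • a + x • b + y • c + z • d = 0 → False := by
    intro a b c d w x y z h hab hac had hw hx hy hz hs hr
    refine hconv a (by simp [h]) (mem_convexHull_of_smul_eq (a := w) (x := -x) (y := -y) (z := -z)
      hw (by linarith) (by linarith) (by linarith) (by linarith) ?_
      (q := b) (r := c) (t := d) ?_ ?_ ?_)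
    · rw [← sub_eq_zero, ← hr]; module
    · simp [h, hab.symm]
    · simp [h, hac.symm]
    · simp [h, had.symm]
  rcases hβ.lt_or_gt with hβ | hβ <;> rcases hγ.lt_or_gt with hγ | hγ <;>
    rcases hδ.lt_or_gt with hδ | hδ
  · exact (hhull hB hpq hpr hpt hα hβ hγ hδ hsum hrel).elim
  · exact separable_of_crossing (p := p) (q := t) (r := q) (t := r)
      (by rw [hB]; ext; simp; tauto) hcard hdisj hgp hpt hpq hpr hqt.symm hrt.symm hqr hα hδ hβ hγ
      (by linarith) (by rw [← hrel]; abel)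
  · exact separable_of_crossing (p := p) (q := r) (r := q) (t := t)
      (by rw [hB]; ext; simp; tauto) hcard hdisj hgp hpr hpq hpt hqr.symm hrt hqt hα hγ hβ hδ
      (by linarith) (by rw [← hrel]; abel)
  · refine (hhull (a := q) (b := p) (c := r) (d := t) (w := -β) (x := -α) (y := -γ) (z := -δ)
      (by rw [hB]; ext; simp; tauto) hpq.symm hqr hqt ?_ ?_ ?_ ?_ ?_ ?_).elim <;> try linarith
    rw [← neg_eq_zero, ← hrel]; module
  · exact separable_of_crossing hB hcard hdisj hgp hpq hpr hpt hqr hqt hrt hα hβ hγ hδ hsum hrel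
  · refine (hhull (a := r) (b := p) (c := q) (d := t) (w := -γ) (x := -α) (y := -β) (z := -δ)
      (by rw [hB]; ext; simp; tauto) hpr.symm hqr.symm hrt ?_ ?_ ?_ ?_ ?_ ?_).elim <;> try linarith
    rw [← neg_eq_zero, ← hrel]; module
  · refine (hhull (a := t) (b := p) (c := q) (d := r) (w := -δ) (x := -α) (y := -β) (z := -γ)
      (by rw [hB]; ext; simp; tauto) hpt.symm hqt.symm hrt.symm ?_ ?_ ?_ ?_ ?_ ?_).elim <;>
      try linarith
    rw [← neg_eq_zero, ← hrel]; module
  · linarith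

/-- Any set of exactly four points in convex position is separable. -/
theorem four_convex_points_separable
    (B R : Finset Pt) (hdisj : Disjoint B R)
    (hgp : StrongGenPos ((↑B ∪ ↑R : Set Pt)))
    (hcard : B.card = 4)
    (hconvpos : ∀ p ∈ B, p ∉ convexHull ℝ (↑(B.erase p) : Set Pt)) :
    Separable B R := by
  obtain ⟨p, B₁, hp, rfl, hB₁⟩ := Finset.card_eq_succ.1 hcard
  obtain ⟨q, r, t, hqr, hqt, hrt, rfl⟩ := Finset.card_eq_three.1 hB₁
  simp only [Finset.mem_insert, Finset.mem_singleton, not_or] at hp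
  obtain ⟨hpq, hpr, hpt⟩ := hp
  have hn : ∀ a ∈ ({p, q, r, t} : Finset Pt), ∀ b ∈ ({p, q, r, t} : Finset Pt),
      ∀ c ∈ ({p, q, r, t} : Finset Pt), a ≠ b → a ≠ c → b ≠ c → det2 (b - a) (c - a) ≠ 0 :=
    fun a ha b hb c hc => hgp.1 a (Or.inl ha) b (Or.inl hb) c (Or.inl hc)
  have hα := hn q (by simp) r (by simp) t (by simp) hqr hqt hrt
  have hβ := hn p (by simp) r (by simp) t (by simp) hpr hpt hrt
  have hγ := hn p (by simp) q (by simp) t (by simp) hpq hpt hqt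
  have hδ := hn p (by simp) q (by simp) r (by simp) hpq hpr hqr
  have hsum : det2 (r - q) (t - q) + -det2 (r - p) (t - p) + det2 (q - p) (t - p) +
      -det2 (q - p) (r - p) = 0 := by
    simp only [det2, PiLp.sub_apply]
    ring
  have hrel : det2 (r - q) (t - q) • p + (-det2 (r - p) (t - p)) • q +
      det2 (q - p) (t - p) • r + (-det2 (q - p) (r - p)) • t = 0 := by
    ext i
    simp only [det2, PiLp.sub_apply, PiLp.add_apply, PiLp.smul_apply, smul_eq_mul, PiLp.zero_apply]
    fin_cases i <;> simp only [Fin.zero_eta, Fin.mk_one] <;> ring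
  rcases hα.lt_or_gt with hα | hα
  · exact separable_of_affine_relation rfl hcard hdisj hgp hconvpos hpq hpr hpt hqr hqt hrt
      (neg_pos.2 hα) (neg_ne_zero.2 (neg_ne_zero.2 hβ)) (neg_ne_zero.2 hγ)
      (neg_ne_zero.2 (neg_ne_zero.2 hδ)) (by linarith) (by rw [← neg_eq_zero, ← hrel]; module)
  · exact separable_of_affine_relation rfl hcard hdisj hgp hconvpos hpq hpr hpt hqr hqt hrt
      hα (neg_ne_zero.2 hβ) hγ (neg_ne_zero.2 hδ) hsum hrel
end
end
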